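/- Let $D$ be a simply connected domain, $\hat o\in D$, $\rho_D=\mathrm{dist}(\hat o,\partial D)$, $\varphi_D:D\to\mathbb{D}$ conformal with $\varphi_D(\hat o)=0$, and $0<\delta<1$. If $K\subset D$ is compact and connected with $\varphi_D(K)\subset(1-\delta)\mathbb{D}$ and $\mathrm{diam}\,\varphi_D(K)\ge\ell$, then $\mathrm{diam}\,K \ge \tfrac{\ell\delta}{8}\rho_D$. -/

import Mathlib

open Set Metric
open MeasureTheory Filter Topology ComplexConjugate

theorem setIntegral_ball_zero_one_eq_circleAverage {F : ℂ → ℂ}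
    (hF : IntegrableOn F (ball 0 1)) :
    ∫ ζ in ball (0 : ℂ) 1, F ζ =
      ∫ ρ in (0 : ℝ)..1, (2 * Real.pi * ρ) • Real.circleAverage F 0 ρ := by
  set H : ℂ → ℂ := (ball (0 : ℂ) 1).indicator F with hH
  have hHint : Integrable H := (integrable_indicator_iff measurableSet_ball).2 hF
  have hpol : ∀ p : ℝ × ℝ, Complex.polarCoord.symm p = circleMap 0 p.1 p.2 := by
    intro p
    simp [circleMap, Complex.exp_mul_I]
  have hprod : IntegrableOn (fun p : ℝ × ℝ => p.1 • H (circleMap 0 p.1 p.2))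
      (Ioi (0 : ℝ) ×ˢ Ioo (-Real.pi) Real.pi) := by
    have := hHint
    rw [← (Complex.volume_preserving_equiv_real_prod.symm).integrable_comp_emb
      Complex.measurableEquivRealProd.symm.measurableEmbedding, ← integrableOn_univ,
      ← integrableOn_congr_set_ae polarCoord_source_ae_eq_univ,
      ← polarCoord.symm_image_target_eq_source,
      integrableOn_image_iff_integrableOn_abs_det_fderiv_smul volume
        polarCoord.open_target.measurableSet
        (fun p _ => (hasFDerivAt_polarCoord_symm p).hasFDerivWithinAt) polarCoord.symm.injOn] at this
    refine (integrableOn_congr_fun ?_ polarCoord.open_target.measurableSet).1 this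
    intro p hp
    have h1 : (0 : ℝ) < p.1 := hp.1
    simp only [Function.comp, det_fderivPolarCoordSymm, abs_of_pos h1]
    rw [← hpol]
    rfl
  rw [← integral_indicator measurableSet_ball, ← Complex.integral_comp_polarCoord_symm]
  simp_rw [hpol]
  rw [polarCoord_target, Measure.volume_eq_prod, setIntegral_prod _ hprod,
    intervalIntegral.integral_of_le zero_le_one, integral_Ioc_eq_integral_Ioo,
    setIntegral_eq_of_subset_of_forall_sdiff_eq_zero measurableSet_Ioi
      (s := Ioo (0 : ℝ) 1) (fun x hx => hx.1)]
  · refine setIntegral_congr_fun measurableSet_Ioo fun ρ hρ => ?_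
    have hmem : ∀ θ : ℝ, circleMap 0 ρ θ ∈ ball (0 : ℂ) 1 := by
      intro θ
      simp [abs_of_pos hρ.1, hρ.2]
    have hval : ∀ θ : ℝ, H (circleMap 0 ρ θ) = F (circleMap 0 ρ θ) := fun θ =>
      indicator_of_mem (hmem θ) F
    simp only [hval]
    rw [integral_smul, Real.circleAverage_eq_integral_add (-Real.pi),
      intervalIntegral.integral_comp_add_right (fun θ => F (circleMap 0 ρ θ)), smul_smul,
      ← integral_Ioc_eq_integral_Ioo, ← intervalIntegral.integral_of_le (by linarith [Real.pi_pos])]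
    have hpi := Real.pi_pos
    congr 1
    · field_simp
    · congr 1 <;> ring
  · intro ρ hρ
    have h1 : 1 ≤ ρ := by
      by_contra h
      exact hρ.2 ⟨hρ.1, not_le.1 h⟩
    have hval : ∀ θ : ℝ, H (circleMap 0 ρ θ) = 0 := by
      intro θ
      refine indicator_of_notMem ?_ F
      simp [abs_of_nonneg (zero_le_one.trans h1), h1]
    simp [hval]

theorem setIntegral_mul_conj_szego {R : ℝ} (hR : 1 < R) {g G : ℂ → ℂ}
    (hG : ∀ ζ ∈ ball (0 : ℂ) R, HasDerivAt G (g ζ) ζ) (hg : DifferentiableOn ℂ g (ball 0 R))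
    {z : ℂ} (hz : ‖z‖ < 1) :
    ∫ ζ in ball (0 : ℂ) 1, g ζ * conj (conj z / (1 - conj z * ζ)) = Real.pi * (G z - G 0) := by
  have hsub : closedBall (0 : ℂ) 1 ⊆ ball 0 R := closedBall_subset_ball hR
  have hne : ∀ ζ ∈ closedBall (0 : ℂ) 1, 1 - conj z * ζ ≠ 0 := by
    intro ζ hζ h
    have h1 : ‖conj z * ζ‖ = 1 := by rw [← sub_eq_zero.1 h, norm_one]
    rw [norm_mul, RCLike.norm_conj] at h1
    have h2 : ‖ζ‖ ≤ 1 := by simpa using hζ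
    nlinarith [norm_nonneg z, norm_nonneg ζ]
  have hint : IntegrableOn (fun ζ => g ζ * conj (conj z / (1 - conj z * ζ))) (ball 0 1) := by
    refine IntegrableOn.mono_set ?_ ball_subset_closedBall
    refine ContinuousOn.integrableOn_compact (isCompact_closedBall _ _) ?_
    refine (hg.continuousOn.mono hsub).mul (Complex.continuous_conj.comp_continuousOn ?_)
    exact continuousOn_const.div (by fun_prop) hne
  rw [setIntegral_ball_zero_one_eq_circleAverage hint]
  have havg : ∀ ρ ∈ Ioo (0 : ℝ) 1,
      Real.circleAverage (fun ζ => g ζ * conj (conj z / (1 - conj z * ζ))) 0 ρ =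
        z * g (z * ρ ^ 2) := by
    intro ρ hρ
    have hw : z * (ρ : ℂ) ^ 2 ∈ ball (0 : ℂ) |ρ| := by
      have : ‖z * (ρ : ℂ) ^ 2‖ = ‖z‖ * ρ ^ 2 := by simp
      rw [mem_ball_zero_iff, this, abs_of_pos hρ.1]
      nlinarith [hρ.1, hρ.2, norm_nonneg z]
    have hd : DiffContOnCl ℂ (fun ζ => z * g ζ) (ball 0 |ρ|) := by
      refine DifferentiableOn.diffContOnCl ?_
      rw [closure_ball _ (abs_pos.2 hρ.1.ne').ne']
      refine (hg.mono ?_).const_mul z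
      refine closedBall_subset_ball ?_
      rw [abs_of_pos hρ.1]
      linarith [hρ.2]
    rw [← hd.circleAverage_smul_div hw]
    refine Real.circleAverage_congr_sphere fun ζ hζ => ?_
    have hζn : ‖ζ‖ = ρ := by simpa [abs_of_pos hρ.1] using hζ
    have hζ0 : ζ ≠ 0 := by
      rintro rfl
      simp at hζn
      linarith [hρ.1]
    have hcc : ζ * conj ζ = (ρ : ℂ) ^ 2 := by
      rw [Complex.mul_conj, Complex.normSq_eq_norm_sq, hζn]
      push_cast
      rfl
    have h1 : 1 - z * conj ζ ≠ 0 := by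
      have := hne ζ (by simp [hζn, hρ.2.le])
      intro h
      apply this
      have := congrArg conj h
      simpa using this
    have h2 : ζ - z * (ρ : ℂ) ^ 2 = ζ * (1 - z * conj ζ) := by
      rw [← hcc]
      ring
    simp only [sub_zero, smul_eq_mul, map_div₀, map_sub, map_mul, map_one, Complex.conj_conj]
    rw [h2]
    field_simp
  have hcurve : ∀ ρ ∈ uIcc (0 : ℝ) 1, z * (ρ : ℂ) ^ 2 ∈ ball (0 : ℂ) R := by
    intro ρ hρ
    rw [uIcc_of_le zero_le_one] at hρ
    have : ‖z * (ρ : ℂ) ^ 2‖ = ‖z‖ * ρ ^ 2 := by simp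
    rw [mem_ball_zero_iff, this]
    nlinarith [hρ.1, hρ.2, norm_nonneg z]
  have hder : ∀ ρ ∈ uIcc (0 : ℝ) 1, HasDerivAt (fun ρ : ℝ => Real.pi * G (z * (ρ : ℂ) ^ 2))
      ((2 * Real.pi * ρ) • (z * g (z * ρ ^ 2))) ρ := by
    intro ρ hρ
    have h1 : HasDerivAt (fun x : ℂ => z * x ^ 2) (z * (2 * (ρ : ℂ))) (ρ : ℂ) := by
      simpa using (hasDerivAt_pow 2 (ρ : ℂ)).const_mul z
    have h2 := (((hG _ (hcurve ρ hρ)).comp (ρ : ℂ) h1).const_mul (Real.pi : ℂ)).comp_ofReal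
    refine h2.congr_deriv ?_
    simp only [Complex.real_smul]
    push_cast
    ring
  have hcont : ContinuousOn (fun ρ : ℝ => (2 * Real.pi * ρ) • (z * g (z * ρ ^ 2)))
      (uIcc (0 : ℝ) 1) := by
    have hk : ContinuousOn (fun ρ : ℝ => g (z * (ρ : ℂ) ^ 2)) (uIcc (0 : ℝ) 1) := hg.continuousOn.comp (f := fun ρ : ℝ => z * (ρ : ℂ) ^ 2) (by fun_prop) hcurve
    exact (Continuous.continuousOn (by fun_prop)).fun_smul (continuousOn_const.fun_mul hk)
  have hFTC := intervalIntegral.integral_eq_sub_of_hasDerivAt hder hcont.intervalIntegrable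
  have hcongr : ∫ ρ in (0 : ℝ)..1, (2 * Real.pi * ρ) • Real.circleAverage
      (fun ζ => g ζ * conj (conj z / (1 - conj z * ζ))) 0 ρ =
      ∫ ρ in (0 : ℝ)..1, (2 * Real.pi * ρ) • (z * g (z * ρ ^ 2)) := by
    rw [intervalIntegral.integral_of_le zero_le_one, intervalIntegral.integral_of_le zero_le_one,
      integral_Ioc_eq_integral_Ioo, integral_Ioc_eq_integral_Ioo]
    exact setIntegral_congr_fun measurableSet_Ioo fun ρ hρ => by simp only [havg ρ hρ]
  rw [hcongr, hFTC]
  push_cast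
  simp
  ring

theorem integrableOn_inv_sub (w : ℂ) (hw : ‖w‖ < 1) :
    IntegrableOn (fun ζ : ℂ => (ζ - w)⁻¹) (ball 0 1) := by
  have h0 : IntegrableOn (fun ζ : ℂ => ζ⁻¹) (ball 0 2) := by
    refine integrableOn_ball_of_norm_le_rpow (C := 1) (α := 1) (by simp) (by simp)
      (Eventually.of_forall fun ζ => ?_) measurable_inv.aestronglyMeasurable
    simp [Real.rpow_neg_one]
  have h1 : Integrable ((ball (0 : ℂ) 2).indicator fun ζ : ℂ => ζ⁻¹) :=
    (integrable_indicator_iff measurableSet_ball).2 h0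
  have h2 := (h1.comp_sub_right w).integrableOn (s := ball (0 : ℂ) 1)
  refine (integrableOn_congr_fun (fun ζ hζ => ?_) measurableSet_ball).1 h2
  refine indicator_of_mem ?_ _
  rw [mem_ball_zero_iff] at hζ ⊢
  linarith [norm_sub_le ζ w]

theorem integrableOn_mul_conj_inv_sub_inv {R : ℝ} (hR : 1 < R) {g : ℂ → ℂ}
    (hg : DifferentiableOn ℂ g (ball 0 R)) {w : ℂ} (hw : ‖w‖ < 1) :
    IntegrableOn (fun ζ => g ζ * conj (ζ⁻¹ - (ζ - w)⁻¹)) (ball 0 1) := by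
  have hcont : ContinuousOn g (closedBall 0 1) :=
    hg.continuousOn.mono (closedBall_subset_ball hR)
  have h1 : IntegrableOn (fun ζ : ℂ => ζ⁻¹ - (ζ - w)⁻¹) (ball 0 1) := by
    have h0 := integrableOn_inv_sub 0 (by simp)
    simp only [sub_zero] at h0
    exact h0.sub (integrableOn_inv_sub w hw)
  have h2 : IntegrableOn (fun ζ : ℂ => conj (ζ⁻¹ - (ζ - w)⁻¹)) (ball 0 1) :=
    Complex.conjCLE.toContinuousLinearMap.integrable_comp h1
  obtain ⟨B, hB⟩ := (isCompact_closedBall (0 : ℂ) 1).exists_bound_of_continuousOn hcont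
  refine Integrable.bdd_mul (c := B) h2 ?_ ?_
  · exact (hcont.mono ball_subset_closedBall).aestronglyMeasurable measurableSet_ball
  · exact (ae_restrict_iff' measurableSet_ball).2
      (Eventually.of_forall fun ζ hζ => hB ζ (ball_subset_closedBall hζ))

theorem setIntegral_mul_conj_inv_sub_inv {R : ℝ} (hR : 1 < R) {g G : ℂ → ℂ}
    (hG : ∀ ζ ∈ ball (0 : ℂ) R, HasDerivAt G (g ζ) ζ) (hg : DifferentiableOn ℂ g (ball 0 R))
    {w : ℂ} (hw : ‖w‖ < 1) (hw0 : w ≠ 0) :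
    ∫ ζ in ball (0 : ℂ) 1, g ζ * conj (ζ⁻¹ - (ζ - w)⁻¹) = Real.pi * (G w - G 0) := by
  have hwpos : 0 < ‖w‖ := norm_pos_iff.2 hw0
  have hcw : conj w ≠ 0 := by simpa using hw0
  rw [setIntegral_ball_zero_one_eq_circleAverage (integrableOn_mul_conj_inv_sub_inv hR hg hw)]
  set F : ℂ → ℂ := fun ζ => g ζ * conj (ζ⁻¹ - (ζ - w)⁻¹) with hFdef
  have hnorm : ∀ ρ : ℝ, ‖(ρ : ℂ) ^ 2 / conj w‖ = ρ ^ 2 / ‖w‖ := by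
    intro ρ
    simp
  have hsphere : ∀ ρ ∈ Ioo (0 : ℝ) 1, ρ ≠ ‖w‖ → ∀ ζ ∈ sphere (0 : ℂ) |ρ|,
      F ζ = (ζ - 0) / (ζ - (ρ : ℂ) ^ 2 / conj w) * (g ζ * ζ / (ρ : ℂ) ^ 2) := by
    intro ρ hρ hρw ζ hζ
    have hζn : ‖ζ‖ = ρ := by simpa [abs_of_pos hρ.1] using hζ
    have hζ0 : ζ ≠ 0 := by
      rintro rfl
      simp at hζn
      linarith [hρ.1]
    have hcζ : conj ζ ≠ 0 := by simpa using hζ0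
    have hcc : (ρ : ℂ) ^ 2 = ζ * conj ζ := by
      rw [Complex.mul_conj, Complex.normSq_eq_norm_sq, hζn]
      push_cast
      rfl
    have hζw : conj ζ - conj w ≠ 0 := by
      intro h
      apply hρw
      rw [← hζn, ← RCLike.norm_conj ζ, sub_eq_zero.1 h, RCLike.norm_conj]
    have h2 : ζ - ζ * conj ζ / conj w = - ζ * (conj ζ - conj w) / conj w := by
      field_simp
      ring
    simp only [hFdef, map_sub, map_inv₀, sub_zero]
    rw [hcc, h2]
    field_simp
    ring
  have hsmall : ∀ ρ ∈ Ioo (0 : ℝ) ‖w‖,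
      Real.circleAverage F 0 ρ = g ((ρ : ℂ) ^ 2 / conj w) / conj w := by
    intro ρ hρ
    have hρ1 : ρ < 1 := hρ.2.trans hw
    have hmem : (ρ : ℂ) ^ 2 / conj w ∈ ball (0 : ℂ) |ρ| := by
      rw [mem_ball_zero_iff, hnorm, abs_of_pos hρ.1, div_lt_iff₀ hwpos]
      nlinarith [hρ.1, hρ.2]
    have hd : DiffContOnCl ℂ (fun ζ => g ζ * ζ / (ρ : ℂ) ^ 2) (ball 0 |ρ|) := by
      refine DifferentiableOn.diffContOnCl ?_
      rw [closure_ball _ (abs_pos.2 hρ.1.ne').ne']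
      refine ((hg.mono (closedBall_subset_ball ?_)).mul differentiableOn_id).div_const _
      rw [abs_of_pos hρ.1]
      linarith
    have hρ0 : (ρ : ℂ) ≠ 0 := by exact_mod_cast hρ.1.ne'
    have hv := hd.circleAverage_smul_div hmem
    rw [Real.circleAverage_congr_sphere (f₁ := F) (c := 0) (R := ρ) (f₂ := fun ζ =>
      ((ζ - 0) / (ζ - (ρ : ℂ) ^ 2 / conj w)) • (g ζ * ζ / (ρ : ℂ) ^ 2))
      (fun ζ hζ => hsphere ρ ⟨hρ.1, hρ1⟩ hρ.2.ne ζ hζ), hv]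
    field_simp
  have hlarge : ∀ ρ ∈ Ioo ‖w‖ 1, Real.circleAverage F 0 ρ = 0 := by
    intro ρ hρ
    have hρ0 : 0 < ρ := hwpos.trans hρ.1
    have hd : DiffContOnCl ℂ
        (fun ζ => (ζ - 0) / (ζ - (ρ : ℂ) ^ 2 / conj w) * (g ζ * ζ / (ρ : ℂ) ^ 2))
        (ball 0 |ρ|) := by
      refine DifferentiableOn.diffContOnCl ?_
      rw [closure_ball _ (abs_pos.2 hρ0.ne').ne', abs_of_pos hρ0]
      refine DifferentiableOn.mul (DifferentiableOn.div (by fun_prop) (by fun_prop) ?_)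
        (((hg.mono (closedBall_subset_ball ?_)).mul differentiableOn_id).div_const _)
      · intro ζ hζ h
        have h1 : ‖ζ‖ = ρ ^ 2 / ‖w‖ := by rw [sub_eq_zero.1 h, hnorm]
        have h2 : ‖ζ‖ ≤ ρ := by simpa using hζ
        rw [h1, div_le_iff₀ hwpos] at h2
        nlinarith [hρ.1]
      · linarith [hρ.2]
    rw [Real.circleAverage_congr_sphere (hsphere ρ ⟨hρ0, hρ.2⟩ hρ.1.ne'), hd.circleAverage]
    simp
  have hcurve : ∀ ρ ∈ uIcc (0 : ℝ) ‖w‖, (ρ : ℂ) ^ 2 / conj w ∈ ball (0 : ℂ) R := by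
    intro ρ hρ
    rw [uIcc_of_le hwpos.le] at hρ
    rw [mem_ball_zero_iff, hnorm, div_lt_iff₀ hwpos]
    nlinarith [hρ.1, hρ.2]
  have hder : ∀ ρ ∈ uIcc (0 : ℝ) ‖w‖,
      HasDerivAt (fun ρ : ℝ => Real.pi * G ((ρ : ℂ) ^ 2 / conj w))
        ((2 * Real.pi * ρ) • (g ((ρ : ℂ) ^ 2 / conj w) / conj w)) ρ := by
    intro ρ hρ
    have h1 : HasDerivAt (fun x : ℂ => x ^ 2 / conj w) ((2 * (ρ : ℂ)) / conj w) (ρ : ℂ) := by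
      simpa using (hasDerivAt_pow 2 (ρ : ℂ)).div_const (conj w)
    have h2 := (((hG _ (hcurve ρ hρ)).comp (ρ : ℂ) h1).const_mul (Real.pi : ℂ)).comp_ofReal
    refine h2.congr_deriv ?_
    simp only [Complex.real_smul]
    push_cast
    ring
  have hcont : ContinuousOn
      (fun ρ : ℝ => (2 * Real.pi * ρ) • (g ((ρ : ℂ) ^ 2 / conj w) / conj w))
      (uIcc (0 : ℝ) ‖w‖) := by
    have hk : ContinuousOn (fun ρ : ℝ => g ((ρ : ℂ) ^ 2 / conj w)) (uIcc (0 : ℝ) ‖w‖) := hg.continuousOn.comp (f := fun ρ : ℝ => (ρ : ℂ) ^ 2 / conj w) (by fun_prop) hcurve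
    exact (Continuous.continuousOn (by fun_prop)).fun_smul (hk.div_const _)
  have hFTC := intervalIntegral.integral_eq_sub_of_hasDerivAt hder hcont.intervalIntegrable
  rw [intervalIntegral.integral_of_le hwpos.le, integral_Ioc_eq_integral_Ioo] at hFTC
  rw [intervalIntegral.integral_of_le zero_le_one, integral_Ioc_eq_integral_Ioo,
    setIntegral_eq_of_subset_of_ae_sdiff_eq_zero measurableSet_Ioo.nullMeasurableSet
      (Ioo_subset_Ioo_right hw.le : Ioo 0 ‖w‖ ⊆ Ioo 0 1),
    setIntegral_congr_fun (g := fun ρ : ℝ =>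
      (2 * Real.pi * ρ) • (g ((ρ : ℂ) ^ 2 / conj w) / conj w)) measurableSet_Ioo
      (fun ρ hρ => by simp only [hsmall ρ hρ]), hFTC]
  · have hww : (‖w‖ : ℂ) ^ 2 / conj w = w := by
      rw [← Complex.mul_conj']
      field_simp
    simp only [hww]
    simp
    ring
  · filter_upwards [compl_mem_ae_iff.2 (measure_singleton (μ := (volume : Measure ℝ)) ‖w‖)] with ρ hρ hρ'
    rw [hlarge ρ ⟨lt_of_le_of_ne (not_lt.1 fun h => hρ'.2 ⟨hρ'.1.1, h⟩) (Ne.symm hρ), hρ'.1.2⟩,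
      smul_zero]

theorem re_one_sub_mul_pos {z ζ : ℂ} {R : ℝ} (hzR : ‖z‖ * R ≤ 1)
    (hζ : ζ ∈ ball (0 : ℂ) R) : 0 < (1 - z * ζ).re := by
  have h1 : ‖z * ζ‖ < 1 := by
    rw [norm_mul]
    have h2 : ‖ζ‖ < R := by simpa using hζ
    rcases (norm_nonneg z).eq_or_lt with h | h
    · simp [← h]
    · nlinarith
  have h3 := Complex.re_le_norm (z * ζ)
  simp only [Complex.sub_re, Complex.one_re]
  linarith

theorem setIntegral_norm_szego_sq {z : ℂ} (hz : ‖z‖ < 1) :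
    ∫ ζ in ball (0 : ℂ) 1, ‖z / (1 - z * ζ)‖ ^ 2 = -Real.pi * Real.log (1 - ‖z‖ ^ 2) := by
  obtain ⟨R, hR, hzR⟩ : ∃ R : ℝ, 1 < R ∧ ‖z‖ * R ≤ 1 := by
    refine ⟨2 - ‖z‖, by linarith, by nlinarith [sq_nonneg (1 - ‖z‖)]⟩
  have hslit : ∀ ζ ∈ ball (0 : ℂ) R, 1 - z * ζ ∈ Complex.slitPlane := fun ζ hζ =>
    Or.inl (re_one_sub_mul_pos hzR hζ)
  have hG : ∀ ζ ∈ ball (0 : ℂ) R,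
      HasDerivAt (fun ζ => -Complex.log (1 - z * ζ)) (z / (1 - z * ζ)) ζ := by
    intro ζ hζ
    have h1 : HasDerivAt (fun ζ : ℂ => 1 - z * ζ) (-z) ζ := by
      simpa using ((hasDerivAt_id ζ).const_mul z).const_sub 1
    refine (h1.clog (hslit ζ hζ)).neg.congr_deriv ?_
    ring
  have hg : DifferentiableOn ℂ (fun ζ => z / (1 - z * ζ)) (ball 0 R) :=
    DifferentiableOn.div (by fun_prop) (by fun_prop)
      fun ζ hζ => Complex.slitPlane_ne_zero (hslit ζ hζ)
  have key := setIntegral_mul_conj_szego hR hG hg (z := conj z) (by simpa using hz)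
  simp only [Complex.conj_conj, Complex.mul_conj'] at key
  have hreal : ((∫ ζ in ball (0 : ℂ) 1, ‖z / (1 - z * ζ)‖ ^ 2 : ℝ) : ℂ) =
      ((-Real.pi * Real.log (1 - ‖z‖ ^ 2) : ℝ) : ℂ) := by
    rw [← integral_complex_ofReal]
    push_cast
    rw [key, Complex.ofReal_log (by nlinarith [norm_nonneg z])]
    push_cast
    simp
  exact_mod_cast hreal

theorem lintegral_image_eq_lintegral_norm_deriv_sq_mul {S : Set ℂ} (hS : MeasurableSet S)
    {T T' : ℂ → ℂ} (hT : ∀ ζ ∈ S, HasDerivAt T (T' ζ) ζ) (hinj : InjOn T S)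
    (u : ℂ → ENNReal) :
    ∫⁻ τ in T '' S, u τ = ∫⁻ ζ in S, ENNReal.ofReal (‖T' ζ‖ ^ 2) * u (T ζ) := by
  rw [lintegral_image_eq_lintegral_abs_det_fderiv_mul volume hS
    (fun ζ hζ => ((hT ζ hζ).hasFDerivAt.restrictScalars ℝ).hasFDerivWithinAt) hinj]
  refine lintegral_congr fun ζ => ?_
  congr 2
  have h : (ContinuousLinearMap.restrictScalars ℝ
      (ContinuousLinearMap.toSpanSingleton ℂ (T' ζ))).det = ‖T' ζ‖ ^ 2 := by
    rw [ContinuousLinearMap.det, ← LinearMap.det_toMatrix Complex.basisOneI, Matrix.det_fin_two]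
    simp [LinearMap.toMatrix_apply, ← Complex.normSq_eq_norm_sq, Complex.normSq_apply]
  rw [h, abs_of_nonneg (by positivity)]

theorem setLIntegral_annulus_inv_norm_sq {x y : ℝ} (hx : 0 < x) (hxy : x < y) :
    ∫⁻ τ in {τ : ℂ | x < ‖τ‖ ∧ ‖τ‖ < y}, ENNReal.ofReal (‖τ‖ ^ 2)⁻¹ =
      ENNReal.ofReal (2 * Real.pi * Real.log (y / x)) := by
  have hmeas : MeasurableSet {τ : ℂ | x < ‖τ‖ ∧ ‖τ‖ < y} :=
    (measurableSet_lt measurable_const measurable_norm).inter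
      (measurableSet_lt measurable_norm measurable_const)
  rw [← lintegral_indicator hmeas, ← Complex.lintegral_comp_polarCoord_symm, polarCoord_target,
    Measure.volume_eq_prod, ← Measure.prod_restrict]
  have hval : ∀ p ∈ Ioi (0 : ℝ) ×ˢ Ioo (-Real.pi) Real.pi,
      ENNReal.ofReal p.1 • {τ : ℂ | x < ‖τ‖ ∧ ‖τ‖ < y}.indicator
        (fun τ => ENNReal.ofReal (‖τ‖ ^ 2)⁻¹) (Complex.polarCoord.symm p) =
      (Ioo x y).indicator (fun ρ => ENNReal.ofReal ρ⁻¹) p.1 := by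
    intro p hp
    have hp0 : 0 < p.1 := hp.1
    have hn : ‖Complex.polarCoord.symm p‖ = p.1 := by
      rw [Complex.norm_polarCoord_symm, abs_of_pos hp0]
    have hiff : Complex.polarCoord.symm p ∈ {τ : ℂ | x < ‖τ‖ ∧ ‖τ‖ < y} ↔ p.1 ∈ Ioo x y := by
      change x < ‖Complex.polarCoord.symm p‖ ∧ ‖Complex.polarCoord.symm p‖ < y ↔ _
      rw [hn, mem_Ioo]
    by_cases h : p.1 ∈ Ioo x y
    · rw [indicator_of_mem h, indicator_of_mem (hiff.2 h), hn,
        smul_eq_mul, ← ENNReal.ofReal_mul hp0.le]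
      congr 1
      field_simp
    · rw [indicator_of_notMem h, indicator_of_notMem (mt hiff.1 h), smul_zero]
  have hm : Measurable ((Ioo x y).indicator fun ρ : ℝ => ENNReal.ofReal ρ⁻¹) :=
    (ENNReal.measurable_ofReal.comp measurable_inv).indicator measurableSet_Ioo
  rw [Measure.prod_restrict, setLIntegral_congr_fun (measurableSet_Ioi.prod measurableSet_Ioo) hval,
    ← Measure.prod_restrict, lintegral_prod _ (by exact (hm.comp measurable_fst).aemeasurable)]
  simp only [lintegral_const, Measure.restrict_apply MeasurableSet.univ, univ_inter,
    Real.volume_Ioo]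
  rw [lintegral_mul_const _ hm, lintegral_indicator measurableSet_Ioo,
      Measure.restrict_restrict measurableSet_Ioo, inter_eq_left.2 (show Ioo x y ⊆ Ioi 0 from fun ρ hρ => hx.trans hρ.1)]
  have hint : IntegrableOn (fun ρ : ℝ => ρ⁻¹) (Ioo x y) := by
    refine (ContinuousOn.integrableOn_Icc ?_).mono_set Ioo_subset_Icc_self
    exact continuousOn_inv₀.mono fun ρ hρ => (hx.trans_le hρ.1).ne'
  rw [← ofReal_integral_eq_lintegral_ofReal hint
    ((ae_restrict_iff' measurableSet_Ioo).2 (Eventually.of_forall fun ρ hρ =>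
      inv_nonneg.2 (hx.trans hρ.1).le)),
    ← integral_Ioc_eq_integral_Ioo, ← intervalIntegral.integral_of_le hxy.le,
    integral_inv_of_pos hx (hx.trans hxy), ← ENNReal.ofReal_mul
      (Real.log_nonneg ((one_le_div hx).2 hxy.le))]
  congr 1
  ring

theorem setLIntegral_image_inv_norm_sq {S : Set ℂ} (hS : MeasurableSet S) {T q : ℂ → ℂ}
    (hT : ∀ ζ ∈ S, HasDerivAt T (q ζ * T ζ) ζ) (hT0 : ∀ ζ ∈ S, T ζ ≠ 0) (hinj : InjOn T S) :
    ∫⁻ τ in T '' S, ENNReal.ofReal (‖τ‖ ^ 2)⁻¹ = ∫⁻ ζ in S, ENNReal.ofReal (‖q ζ‖ ^ 2) := by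
  rw [lintegral_image_eq_lintegral_norm_deriv_sq_mul hS hT hinj]
  refine setLIntegral_congr_fun hS fun ζ hζ => ?_
  have h0 : ‖T ζ‖ ≠ 0 := norm_ne_zero_iff.2 (hT0 ζ hζ)
  rw [← ENNReal.ofReal_mul (by positivity), norm_mul]
  congr 1
  field_simp

theorem setLIntegral_norm_logDeriv_sq_le {S : Set ℂ} (hS : MeasurableSet S) {T q : ℂ → ℂ}
    (hT : ∀ ζ ∈ S, HasDerivAt T (q ζ * T ζ) ζ) (hinj : InjOn T S) {x y : ℝ} (hx : 0 < x)
    (hxy : x < y) (hmaps : ∀ ζ ∈ S, x < ‖T ζ‖ ∧ ‖T ζ‖ < y) :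
    ∫⁻ ζ in S, ENNReal.ofReal (‖q ζ‖ ^ 2) ≤ ENNReal.ofReal (2 * Real.pi * Real.log (y / x)) := by
  rw [← setLIntegral_image_inv_norm_sq hS hT
    (fun ζ hζ => norm_pos_iff.1 (hx.trans (hmaps ζ hζ).1)) hinj,
    ← setLIntegral_annulus_inv_norm_sq hx hxy]
  exact lintegral_mono_set (image_subset_iff.2 hmaps)

theorem setLIntegral_norm_inv_sub_inv_sq {w : ℂ} (hw : w ≠ 0) {x y : ℝ} (hx : 0 < x)
    (hxy : x < y) :
    ∫⁻ ζ in {ζ : ℂ | x < ‖ζ / (ζ - w)‖ ∧ ‖ζ / (ζ - w)‖ < y},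
        ENNReal.ofReal (‖ζ⁻¹ - (ζ - w)⁻¹‖ ^ 2) =
      ENNReal.ofReal (2 * Real.pi * Real.log (y / x)) := by
  have hmM : Measurable fun ζ : ℂ => ‖ζ / (ζ - w)‖ := by fun_prop
  have hS : MeasurableSet {ζ : ℂ | x < ‖ζ / (ζ - w)‖ ∧ ‖ζ / (ζ - w)‖ < y} :=
    (measurableSet_lt measurable_const hmM).inter (measurableSet_lt hmM measurable_const)
  have hne : ∀ ζ ∈ {ζ : ℂ | x < ‖ζ / (ζ - w)‖ ∧ ‖ζ / (ζ - w)‖ < y}, ζ ≠ 0 ∧ ζ - w ≠ 0 := by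
    intro ζ hζ
    have h : ζ / (ζ - w) ≠ 0 := norm_pos_iff.1 (hx.trans hζ.1)
    exact div_ne_zero_iff.1 h
  rw [← setLIntegral_image_inv_norm_sq hS (T := fun ζ => ζ / (ζ - w))]
  · rw [← setLIntegral_annulus_inv_norm_sq hx hxy]
    refine setLIntegral_congr ?_
    have himg : (fun ζ => ζ / (ζ - w)) '' {ζ : ℂ | x < ‖ζ / (ζ - w)‖ ∧ ‖ζ / (ζ - w)‖ < y} =
        {τ : ℂ | x < ‖τ‖ ∧ ‖τ‖ < y} \ {1} := by
      ext τ
      constructor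
      · rintro ⟨ζ, hζ, rfl⟩
        refine ⟨hζ, fun h => hw ?_⟩
        rw [mem_singleton_iff, div_eq_one_iff_eq (hne ζ hζ).2] at h
        linear_combination h
      · rintro ⟨hτ, h1⟩
        have h1 : τ - 1 ≠ 0 := sub_ne_zero.2 h1
        have h2 : w * τ / (τ - 1) / (w * τ / (τ - 1) - w) = τ := by
          have : w * τ / (τ - 1) - w = w / (τ - 1) := by field_simp; ring
          rw [this]
          field_simp
        refine ⟨w * τ / (τ - 1), ?_, h2⟩
        change x < ‖w * τ / (τ - 1) / (w * τ / (τ - 1) - w)‖ ∧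
          ‖w * τ / (τ - 1) / (w * τ / (τ - 1) - w)‖ < y
        rw [h2]
        exact hτ
    rw [himg]
    exact sdiff_null_ae_eq_self (by simp)
  · intro ζ hζ
    obtain ⟨h0, h1⟩ := hne ζ hζ
    refine ((hasDerivAt_id ζ).fun_div ((hasDerivAt_id ζ).sub_const w) h1).congr_deriv ?_
    simp only [id]
    field_simp
  · intro ζ hζ
    exact div_ne_zero (hne ζ hζ).1 (hne ζ hζ).2
  · intro ζ hζ ξ hξ h
    simp only at h
    rw [div_eq_div_iff (hne ζ hζ).2 (hne ξ hξ).2] at h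
    exact mul_left_cancel₀ hw (by linear_combination -h)

theorem setLIntegral_compl_ball_norm_inv_sub_inv_sq {w : ℂ} (hw : ‖w‖ < 1) :
    ∫⁻ ζ in (ball (0 : ℂ) 1)ᶜ, ENNReal.ofReal (‖ζ⁻¹ - (ζ - w)⁻¹‖ ^ 2) ≤
      ENNReal.ofReal (-Real.pi * Real.log (1 - ‖w‖ ^ 2)) := by
  have hne : ∀ ζ ∈ closedBall (0 : ℂ) 1, 1 - w * ζ ≠ 0 := by
    intro ζ hζ h
    have h1 : ‖w * ζ‖ = 1 := by rw [← sub_eq_zero.1 h, norm_one]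
    rw [norm_mul] at h1
    have : ‖ζ‖ ≤ 1 := by simpa using hζ
    nlinarith [norm_nonneg ζ, norm_nonneg w]
  have hsub : (ball (0 : ℂ) 1)ᶜ ⊆ Inv.inv '' (closedBall (0 : ℂ) 1 \ {0}) := by
    intro ζ hζ
    have h1 : 1 ≤ ‖ζ‖ := by simpa using hζ
    refine ⟨ζ⁻¹, ⟨?_, ?_⟩, inv_inv ζ⟩
    · simpa using inv_le_one_of_one_le₀ h1
    · rw [mem_singleton_iff, inv_eq_zero, ← norm_eq_zero]
      linarith
  have hmeas : MeasurableSet (closedBall (0 : ℂ) 1 \ {0}) :=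
    measurableSet_closedBall.diff (measurableSet_singleton 0)
  refine (lintegral_mono_set hsub).trans ?_
  rw [lintegral_image_eq_lintegral_norm_deriv_sq_mul hmeas
    (fun ζ hζ => hasDerivAt_inv hζ.2) inv_injective.injOn]
  rw [setLIntegral_congr_fun (g := fun ζ => ENNReal.ofReal (‖w / (1 - w * ζ)‖ ^ 2)) hmeas]
  · refine (lintegral_mono_set sdiff_subset).trans ?_
    have hcont : ContinuousOn (fun ζ => ‖w / (1 - w * ζ)‖ ^ 2) (closedBall 0 1) :=
      ((continuousOn_const.div (by fun_prop) hne).norm).pow 2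
    rw [← ofReal_integral_eq_lintegral_ofReal (hcont.integrableOn_compact (isCompact_closedBall 0 1))
      (Eventually.of_forall fun ζ => by positivity), ← setIntegral_norm_szego_sq hw]
    refine le_of_eq (congrArg _ (setIntegral_congr_set ?_))
    refine (ae_eq_of_subset_of_measure_ge ball_subset_closedBall ?_
      measurableSet_ball.nullMeasurableSet measure_closedBall_lt_top.ne).symm
    rw [Measure.addHaar_closedBall_eq_addHaar_ball]
  · intro ζ hζ
    have h0 : ζ ≠ 0 := hζ.2
    have h1 := hne ζ hζ.1
    simp only
    rw [← ENNReal.ofReal_mul (by positivity), ← mul_pow, ← norm_mul, inv_inv]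
    congr 2
    have h2 : ζ⁻¹ - w ≠ 0 := by
      intro h
      apply h1
      rw [← sub_eq_zero.1 h]
      field_simp
      ring
    have h3 : (ζ⁻¹ - w)⁻¹ = ζ / (1 - w * ζ) := by
      field_simp
    have h4 : ζ - ζ / (1 - w * ζ) = -(ζ ^ 2 * (w / (1 - w * ζ))) := by
      rw [sub_eq_iff_eq_add, ← mul_div_assoc, ← neg_div, ← add_div, eq_div_iff h1]
      ring
    rw [h3, h4, neg_mul_neg, inv_mul_cancel_left₀ (pow_ne_zero 2 h0)]

theorem exists_exp_eq_of_differentiableOn_ball {c : ℂ} {R : ℝ} {E : ℂ → ℂ}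
    (hE : DifferentiableOn ℂ E (ball c R)) (hE0 : ∀ ζ ∈ ball c R, E ζ ≠ 0) :
    ∃ A : ℂ → ℂ, (∀ ζ ∈ ball c R, HasDerivAt A (deriv E ζ / E ζ) ζ) ∧
      ∀ ζ ∈ ball c R, Complex.exp (A ζ) = E ζ := by
  rcases le_or_gt R 0 with hR | hR
  · exact ⟨0, by simp [ball_eq_empty.2 hR], by simp [ball_eq_empty.2 hR]⟩
  have hc : c ∈ ball c R := mem_ball_self hR
  obtain ⟨A, hA⟩ := ((hE.deriv isOpen_ball).fun_div hE hE0).isExactOn_ball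
  have hA' : ∀ ζ ∈ ball c R,
      HasDerivAt (fun ζ => A ζ + (Complex.log (E c) - A c)) (deriv E ζ / E ζ) ζ :=
    fun ζ hζ => (hA ζ hζ).add_const _
  refine ⟨_, hA', fun ζ hζ => ?_⟩
  have hd : ∀ ζ ∈ ball c R,
      HasDerivAt (fun ζ => Complex.exp (A ζ + (Complex.log (E c) - A c)) / E ζ) 0 ζ := by
    intro ζ hζ
    have h0 := hE0 ζ hζ
    refine ((hA' ζ hζ).cexp.fun_div
      (hE.differentiableAt (isOpen_ball.mem_nhds hζ)).hasDerivAt h0).congr_deriv ?_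
    field_simp
    ring
  have hconst := isOpen_ball.is_const_of_deriv_eq_zero (convex_ball c R).isPreconnected
    (fun ζ hζ => (hd ζ hζ).differentiableAt.differentiableWithinAt)
    (fun ζ hζ => (hd ζ hζ).deriv) hζ hc
  simp only [add_sub_cancel, Complex.exp_log (hE0 c hc), div_self (hE0 c hc)] at hconst
  exact (div_eq_one_iff_eq (hE0 ζ hζ)).1 hconst

theorem IsCompact.exists_pos_le_dist_of_injOn {X Y : Type*} [TopologicalSpace X] [MetricSpace Y]
    {s : Set X} (hs : IsCompact s) {f : X → Y} (hf : ContinuousOn f s) (hinj : InjOn f s) {c : X}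
    (hc : c ∈ s) {V : Set X} (hV : V ∈ 𝓝 c) :
    ∃ r > 0, ∀ ζ ∈ s, ζ ∉ V → r ≤ dist (f ζ) (f c) := by
  obtain ⟨U, hUV, hU, hcU⟩ := mem_nhds_iff.1 hV
  obtain ⟨r, hr, h⟩ := (hs.diff hU).exists_forall_le' (f := fun ζ => dist (f ζ) (f c))
    (continuous_dist.comp_continuousOn
      ((hf.mono sdiff_subset).prodMk continuousOn_const)) (a := 0) fun ζ hζ => by
      refine dist_pos.2 fun h => hζ.2 ?_
      rw [hinj hζ.1 hc h]
      exact hcU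
  exact ⟨r, hr, fun ζ hζ hζV => h ζ ⟨hζ, fun h => hζV (hUV h)⟩⟩

theorem setIntegral_sub_norm_sq_le {X : Type*} [MeasurableSpace X] {μ : Measure X}
    {N : Set X} {q s : X → ℂ} (hq : AEStronglyMeasurable q (μ.restrict N))
    (hs : AEStronglyMeasurable s (μ.restrict N)) {Q S : ℝ} (hQ0 : 0 ≤ Q)
    (hQ : ∫⁻ ζ in N, ENNReal.ofReal (‖q ζ‖ ^ 2) ∂μ ≤ ENNReal.ofReal Q)
    (hS : ENNReal.ofReal S ≤ ∫⁻ ζ in N, ENNReal.ofReal (‖s ζ‖ ^ 2) ∂μ)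
    (hfin : ∫⁻ ζ in N, ENNReal.ofReal (‖s ζ‖ ^ 2) ∂μ ≠ ⊤) :
    ∫ ζ in N, (‖q ζ‖ ^ 2 - ‖s ζ‖ ^ 2) ∂μ ≤ Q - S := by
  have hint : ∀ {p : X → ℂ}, AEStronglyMeasurable p (μ.restrict N) →
      ∫⁻ ζ in N, ENNReal.ofReal (‖p ζ‖ ^ 2) ∂μ ≠ ⊤ → IntegrableOn (fun ζ => ‖p ζ‖ ^ 2) N μ :=
    fun hp h => (lintegral_ofReal_ne_top_iff_integrable (hp.norm.pow 2)
      (Eventually.of_forall fun ζ => sq_nonneg _)).1 h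
  have hiq := hint hq (ne_top_of_le_ne_top ENNReal.ofReal_ne_top hQ)
  have his := hint hs hfin
  rw [← ofReal_integral_eq_lintegral_ofReal hiq (Eventually.of_forall fun ζ => by positivity),
    ENNReal.ofReal_le_ofReal_iff hQ0] at hQ
  rw [← ofReal_integral_eq_lintegral_ofReal his (Eventually.of_forall fun ζ => by positivity),
    ENNReal.ofReal_le_ofReal_iff (integral_nonneg fun ζ => by positivity)] at hS
  rw [integral_sub hiq his]
  linarith

theorem ofReal_le_setLIntegral_inter_ball {w : ℂ} (hw : ‖w‖ < 1) (hw0 : w ≠ 0) {x y : ℝ}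
    (hx : 0 < x) (hxy : x < y) :
    ENNReal.ofReal (2 * Real.pi * Real.log (y / x) - -Real.pi * Real.log (1 - ‖w‖ ^ 2)) ≤
      ∫⁻ ζ in {ζ : ℂ | x < ‖ζ / (ζ - w)‖ ∧ ‖ζ / (ζ - w)‖ < y} ∩ ball 0 1,
        ENNReal.ofReal (‖ζ⁻¹ - (ζ - w)⁻¹‖ ^ 2) := by
  have hB : 0 ≤ -Real.pi * Real.log (1 - ‖w‖ ^ 2) := by
    rw [← setIntegral_norm_szego_sq hw]
    exact integral_nonneg fun ζ => by positivity
  rw [ENNReal.ofReal_sub _ hB, tsub_le_iff_right, ← setLIntegral_norm_inv_sub_inv_sq hw0 hx hxy,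
    ← lintegral_inter_add_sdiff _ _ (measurableSet_ball (x := (0 : ℂ)) (ε := 1))]
  gcongr
  exact (lintegral_mono_set fun ζ hζ => hζ.2).trans
    (setLIntegral_compl_ball_norm_inv_sub_inv_sq hw)

theorem dslope_ne_zero_of_injOn {U : Set ℂ} {f : ℂ → ℂ} (hinj : InjOn f U)
    (hf' : ∀ ζ ∈ U, deriv f ζ ≠ 0) {c ζ : ℂ} (hc : c ∈ U) (hζ : ζ ∈ U) : dslope f c ζ ≠ 0 := by
  rcases eq_or_ne ζ c with rfl | h
  · rw [dslope_same]
    exact hf' ζ hζ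
  · rw [dslope_of_ne _ h, slope_def_field]
    exact div_ne_zero (sub_ne_zero.2 fun h' => h (hinj hζ hc h')) (sub_ne_zero.2 h)

theorem div_div_dslope_div_dslope {f : ℂ → ℂ} (hf0 : f 0 = 0) {w ζ : ℂ} (hζ : ζ ≠ 0)
    (hζw : ζ ≠ w) :
    ζ / (ζ - w) / (dslope f w ζ / dslope f 0 ζ) = f ζ / (f ζ - f w) := by
  rw [dslope_of_ne _ hζ, dslope_of_ne _ hζw, slope_def_field, slope_def_field, hf0, sub_zero,
    sub_zero]
  have h1 : ζ - w ≠ 0 := sub_ne_zero.2 hζw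
  rcases eq_or_ne (f ζ - f w) 0 with h | h
  · simp [h]
  rcases eq_or_ne (f ζ) 0 with h' | h'
  · simp [h']
  field_simp

theorem eventually_norm_div_dslope_mem {R : ℝ} (hR : 1 < R) {f : ℂ → ℂ}
    (hf : DifferentiableOn ℂ f (ball 0 R)) (hinj : InjOn f (ball 0 R)) (hf0 : f 0 = 0)
    {w : ℂ} (hw : ‖w‖ < 1) {E : ℂ → ℂ} (hE : ∀ ζ, E ζ = dslope f w ζ / dslope f 0 ζ)
    (hEd : DifferentiableOn ℂ E (ball 0 R)) (hE0 : ∀ ζ ∈ ball (0 : ℂ) R, E ζ ≠ 0)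
    {η : ℝ} (hη : 0 < η) :
    ∀ᶠ n : ℕ in atTop, ∀ ζ ∈ {ζ : ℂ | Real.exp (-n) < ‖ζ / (ζ - w)‖ ∧
      ‖ζ / (ζ - w)‖ < Real.exp n} ∩ ball 0 1,
      Real.exp (-n - η) / ‖E 0‖ < ‖ζ / (ζ - w) / E ζ‖ ∧
        ‖ζ / (ζ - w) / E ζ‖ < Real.exp (n + η) / ‖E w‖ := by
  have hsub : closedBall (0 : ℂ) 1 ⊆ ball 0 R := closedBall_subset_ball hR
  have hw1 : w ∈ closedBall (0 : ℂ) 1 := by simpa using hw.le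
  have h01 : (0 : ℂ) ∈ closedBall (0 : ℂ) 1 := by simp
  have hfc : ContinuousOn f (closedBall 0 1) := hf.continuousOn.mono hsub
  have hcont : ∀ c ∈ closedBall (0 : ℂ) 1, ContinuousAt (fun ζ => ‖E ζ‖) c := fun c hc =>
    (hEd.differentiableAt (isOpen_ball.mem_nhds (hsub hc))).continuousAt.norm
  have hpos : ∀ c ∈ closedBall (0 : ℂ) 1, 0 < ‖E c‖ := fun c hc => norm_pos_iff.2 (hE0 c (hsub hc))
  have hexp : 1 < Real.exp η := Real.one_lt_exp_iff.2 hη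
  obtain ⟨r₀, hr₀, hV₀⟩ := (isCompact_closedBall (0 : ℂ) 1).exists_pos_le_dist_of_injOn hfc
    (hinj.mono hsub) h01 ((hcont 0 h01).eventually_lt_const
      (show ‖E 0‖ < Real.exp η * ‖E 0‖ by nlinarith [hpos 0 h01]))
  obtain ⟨r₁, hr₁, hV₁⟩ := (isCompact_closedBall (0 : ℂ) 1).exists_pos_le_dist_of_injOn hfc
    (hinj.mono hsub) hw1 ((hcont w hw1).eventually_const_lt
      (show Real.exp (-η) * ‖E w‖ < ‖E w‖ by
        nlinarith [hpos w hw1, Real.exp_lt_one_iff.2 (neg_lt_zero.2 hη)]))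
  obtain ⟨B, hB⟩ := (isCompact_closedBall (0 : ℂ) 1).exists_bound_of_continuousOn hfc
  have hB0 : 0 ≤ B := (norm_nonneg _).trans (hB 0 h01)
  have hcast : Tendsto (fun n : ℕ => (n : ℝ)) atTop atTop := tendsto_natCast_atTop_atTop
  have hsmall : ∀ᶠ n : ℕ in atTop, Real.exp (-n - η) / ‖E 0‖ < r₀ / (2 * B + 1) := by
    have : Tendsto (fun n : ℕ => Real.exp (-n - η) / ‖E 0‖) atTop (𝓝 (0 / ‖E 0‖)) := by
      refine Tendsto.div_const (Real.tendsto_exp_atBot.comp ?_) _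
      exact tendsto_atBot_add_const_right _ (-η) (tendsto_neg_atTop_atBot.comp hcast)
    rw [zero_div] at this
    exact this.eventually_lt_const (by positivity)
  have hlarge : ∀ᶠ n : ℕ in atTop, B / r₁ < Real.exp (n + η) / ‖E w‖ := by
    refine Tendsto.eventually_gt_atTop (Tendsto.atTop_div_const (hpos w hw1)
      (Real.tendsto_exp_atTop.comp (tendsto_atTop_add_const_right _ η hcast))) _
  filter_upwards [hsmall, hlarge] with n hn₀ hn₁ ζ ⟨⟨hM0, hM1⟩, hζ⟩
  have hζc : ζ ∈ closedBall (0 : ℂ) 1 := ball_subset_closedBall hζ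
  have hMne : ζ / (ζ - w) ≠ 0 := norm_pos_iff.1 ((Real.exp_pos _).trans hM0)
  obtain ⟨hζ0, hζw⟩ := div_ne_zero_iff.1 hMne
  have hζw : ζ ≠ w := sub_ne_zero.1 hζw
  have hT : ‖ζ / (ζ - w) / E ζ‖ = ‖f ζ‖ / ‖f ζ - f w‖ := by
    rw [hE, div_div_dslope_div_dslope hf0 hζ0 hζw, norm_div]
  have hden : 0 < ‖f ζ - f w‖ := norm_pos_iff.2 (sub_ne_zero.2 fun h => hζw
    (hinj (hsub hζc) (hsub hw1) h))
  have hEζ := hpos ζ hζc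
  constructor
  · by_cases hV : ‖E ζ‖ < Real.exp η * ‖E 0‖
    · rw [norm_div, div_lt_div_iff₀ (hpos 0 h01) hEζ]
      have h1 : Real.exp (-n - η) * Real.exp η = Real.exp (-n) := by
        rw [← Real.exp_add]; ring_nf
      calc Real.exp (-n - η) * ‖E ζ‖ < Real.exp (-n - η) * (Real.exp η * ‖E 0‖) := by gcongr
        _ = Real.exp (-n) * ‖E 0‖ := by rw [← mul_assoc, h1]
        _ < _ := by have := hpos 0 h01; gcongr
    · have h := hV₀ ζ hζc hV
      rw [hf0, dist_zero_right] at h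
      refine hn₀.trans_le ?_
      rw [hT]
      have h2 : ‖f ζ - f w‖ ≤ 2 * B + 1 :=
        (norm_sub_le _ _).trans (by linarith [hB ζ hζc, hB w hw1])
      gcongr
  · by_cases hV : Real.exp (-η) * ‖E w‖ < ‖E ζ‖
    · rw [norm_div, div_lt_div_iff₀ hEζ (hpos w hw1)]
      have h1 : Real.exp (n + η) * Real.exp (-η) = Real.exp n := by
        rw [← Real.exp_add]; ring_nf
      calc ‖ζ / (ζ - w)‖ * ‖E w‖ < Real.exp n * ‖E w‖ := by have := hpos w hw1; gcongr
        _ = Real.exp (n + η) * (Real.exp (-η) * ‖E w‖) := by rw [← mul_assoc, h1]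
        _ < _ := by gcongr
    · have h := hV₁ ζ hζc hV
      rw [dist_eq_norm] at h
      refine lt_of_le_of_lt ?_ hn₁
      rw [hT]
      have := hB ζ hζc
      gcongr

theorem setIntegral_norm_logDeriv_dslope_sq_le {R : ℝ} (hR : 1 < R) {f : ℂ → ℂ}
    (hf : DifferentiableOn ℂ f (ball 0 R)) (hinj : InjOn f (ball 0 R)) (hf0 : f 0 = 0)
    {w : ℂ} (hw : ‖w‖ < 1) (hw0 : w ≠ 0)
    {E : ℂ → ℂ} (hE : ∀ ζ, E ζ = dslope f w ζ / dslope f 0 ζ)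
    (hEd : DifferentiableOn ℂ E (ball 0 R)) (hE0 : ∀ ζ ∈ ball (0 : ℂ) R, E ζ ≠ 0) :
    ∫ ζ in ball (0 : ℂ) 1, ‖deriv E ζ / E ζ‖ ^ 2 ≤ -Real.pi * Real.log (1 - ‖w‖ ^ 2) := by
  have hsub : closedBall (0 : ℂ) 1 ⊆ ball 0 R := closedBall_subset_ball hR
  have hwR : w ∈ ball (0 : ℂ) R := by simpa using hw.trans hR
  have h0R : (0 : ℂ) ∈ ball (0 : ℂ) R := by simpa using one_pos.trans hR
  have hEw : 0 < ‖E w‖ := norm_pos_iff.2 (hE0 w hwR)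
  have hEz : 0 < ‖E 0‖ := norm_pos_iff.2 (hE0 0 h0R)
  obtain ⟨A, hA, hAE⟩ := exists_exp_eq_of_differentiableOn_ball hEd hE0
  have hAre : ∀ ζ ∈ ball (0 : ℂ) R, (A ζ).re = Real.log ‖E ζ‖ := fun ζ hζ => by
    rw [← hAE ζ hζ, Complex.norm_exp, Real.log_exp]
  set a : ℂ → ℂ := fun ζ => deriv E ζ / E ζ with ha_def
  set s : ℂ → ℂ := fun ζ => ζ⁻¹ - (ζ - w)⁻¹ with hs_def
  have ha : DifferentiableOn ℂ a (ball 0 R) := (hEd.deriv isOpen_ball).fun_div hEd hE0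
  have haint : IntegrableOn (fun ζ => ‖a ζ‖ ^ 2) (ball 0 1) :=
    (((ha.continuousOn.mono hsub).norm.pow 2).integrableOn_compact
      (isCompact_closedBall 0 1)).mono_set ball_subset_closedBall
  have hasint : IntegrableOn (fun ζ => a ζ * conj (s ζ)) (ball 0 1) :=
    integrableOn_mul_conj_inv_sub_inv hR ha hw
  have hreint : IntegrableOn (fun ζ => 2 * (a ζ * conj (s ζ)).re) (ball 0 1) :=
    hasint.re.const_mul 2
  have hFint : IntegrableOn (fun ζ => ‖a ζ‖ ^ 2 - 2 * (a ζ * conj (s ζ)).re) (ball 0 1) :=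
    haint.sub hreint
  have hFval : ∫ ζ in ball (0 : ℂ) 1, (‖a ζ‖ ^ 2 - 2 * (a ζ * conj (s ζ)).re) =
      (∫ ζ in ball (0 : ℂ) 1, ‖a ζ‖ ^ 2) -
        2 * (Real.pi * (Real.log ‖E w‖ - Real.log ‖E 0‖)) := by
    rw [integral_sub haint hreint, integral_const_mul]
    congr 2
    refine (integral_re hasint).trans ?_
    rw [setIntegral_mul_conj_inv_sub_inv hR hA ha hw hw0, ← hAre w hwR, ← hAre 0 h0R]
    simp
  set N : ℕ → Set ℂ := fun n => {ζ : ℂ | Real.exp (-n) < ‖ζ / (ζ - w)‖ ∧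
    ‖ζ / (ζ - w)‖ < Real.exp n} ∩ ball 0 1 with hN_def
  have hmM : Measurable fun ζ : ℂ => ‖ζ / (ζ - w)‖ := by fun_prop
  have hNm : ∀ n, MeasurableSet (N n) := fun n =>
    ((measurableSet_lt measurable_const hmM).inter
      (measurableSet_lt hmM measurable_const)).inter measurableSet_ball
  have hNmono : Monotone N := by
    rintro m n hmn ζ ⟨⟨h1, h2⟩, h3⟩
    have hmn' : (m : ℝ) ≤ n := Nat.cast_le.2 hmn
    exact ⟨⟨(Real.exp_le_exp.2 (neg_le_neg hmn')).trans_lt h1,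
      h2.trans_le (Real.exp_le_exp.2 hmn')⟩, h3⟩
  have hNunion : ⋃ n, N n = ball (0 : ℂ) 1 \ {0, w} := by
    ext ζ
    constructor
    · intro h
      obtain ⟨n, ⟨h1, -⟩, h3⟩ := mem_iUnion.1 h
      have h4 := div_ne_zero_iff.1 (norm_pos_iff.1 ((Real.exp_pos _).trans h1))
      exact ⟨h3, by rintro (h | h); exacts [h4.1 h, h4.2 (sub_eq_zero.2 h)]⟩
    · rintro ⟨h3, h4⟩
      simp only [mem_insert_iff, mem_singleton_iff, not_or] at h4
      have hpos : 0 < ‖ζ / (ζ - w)‖ :=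
        norm_pos_iff.2 (div_ne_zero h4.1 (sub_ne_zero.2 h4.2))
      obtain ⟨n, hn⟩ := exists_nat_gt |Real.log ‖ζ / (ζ - w)‖|
      rw [abs_lt] at hn
      exact mem_iUnion.2 ⟨n, ⟨(Real.lt_log_iff_exp_lt hpos).1 hn.1,
        (Real.log_lt_iff_lt_exp hpos).1 hn.2⟩, h3⟩
  have hNae : (⋃ n, N n : Set ℂ) =ᵐ[volume] ball (0 : ℂ) 1 := by
    rw [hNunion]
    exact sdiff_null_ae_eq_self ((Set.toFinite _).measure_zero _)
  have hlim : Tendsto (fun n => ∫ ζ in N n, (‖a ζ‖ ^ 2 - 2 * (a ζ * conj (s ζ)).re)) atTop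
      (𝓝 ((∫ ζ in ball (0 : ℂ) 1, ‖a ζ‖ ^ 2) -
        2 * (Real.pi * (Real.log ‖E w‖ - Real.log ‖E 0‖)))) := by
    rw [← hFval, ← setIntegral_congr_set hNae]
    exact tendsto_setIntegral_of_monotone hNm hNmono
      (hFint.mono_set (by rw [hNunion]; exact sdiff_subset))
  have hne : ∀ {n ζ}, ζ ∈ N n → ζ ≠ 0 ∧ ζ - w ≠ 0 := fun {n ζ} hζ =>
    div_ne_zero_iff.1 (norm_pos_iff.1 ((Real.exp_pos _).trans hζ.1.1))
  have hderiv : ∀ n, ∀ ζ ∈ N n, HasDerivAt (fun ζ => ζ / (ζ - w) / E ζ)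
      ((s ζ - a ζ) * (ζ / (ζ - w) / E ζ)) ζ := by
    intro n ζ hζ
    have hζR : ζ ∈ ball (0 : ℂ) R := hsub (ball_subset_closedBall hζ.2)
    obtain ⟨h0, h1⟩ := hne hζ
    have h2 := hE0 ζ hζR
    refine (((hasDerivAt_id ζ).fun_div ((hasDerivAt_id ζ).sub_const w) h1).fun_div
      (hEd.differentiableAt (isOpen_ball.mem_nhds hζR)).hasDerivAt h2).congr_deriv ?_
    simp only [id, ha_def, hs_def]
    field_simp
  have hTinj : ∀ n, InjOn (fun ζ => ζ / (ζ - w) / E ζ) (N n) := by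
    intro n ζ hζ ξ hξ h
    have hζR : ζ ∈ ball (0 : ℂ) R := hsub (ball_subset_closedBall hζ.2)
    have hξR : ξ ∈ ball (0 : ℂ) R := hsub (ball_subset_closedBall hξ.2)
    have hζw := sub_ne_zero.1 (hne hζ).2
    have hξw := sub_ne_zero.1 (hne hξ).2
    simp only [hE] at h
    rw [div_div_dslope_div_dslope hf0 (hne hζ).1 hζw, div_div_dslope_div_dslope hf0 (hne hξ).1 hξw,
      div_eq_div_iff (sub_ne_zero.2 fun h => hζw (hinj hζR hwR h))
        (sub_ne_zero.2 fun h => hξw (hinj hξR hwR h))] at h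
    have hfw : f w ≠ 0 := fun h => hw0 (hinj hwR h0R (h.trans hf0.symm))
    exact hinj hζR hξR (mul_left_cancel₀ hfw (by linear_combination -h))
  have hsm : Measurable s := by fun_prop
  refine le_of_forall_pos_le_add fun ε hε => ?_
  obtain ⟨η, hη, rfl⟩ : ∃ η, 0 < η ∧ 4 * Real.pi * η = ε :=
    ⟨ε / (4 * Real.pi), by positivity, by field_simp⟩
  have hxy : ∀ᶠ n : ℕ in atTop, Real.exp (-n - η) / ‖E 0‖ < Real.exp (n + η) / ‖E w‖ := by
    have h1 : Tendsto (fun n : ℕ => Real.exp (n + η) / ‖E w‖) atTop atTop :=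
      Tendsto.atTop_div_const hEw (Real.tendsto_exp_atTop.comp
        (tendsto_atTop_add_const_right _ η tendsto_natCast_atTop_atTop))
    filter_upwards [h1.eventually_gt_atTop (1 / ‖E 0‖)] with n hn
    refine lt_of_le_of_lt ?_ hn
    have : Real.exp (-n - η) ≤ 1 := Real.exp_le_one_iff.2 (by linarith [n.cast_nonneg (α := ℝ)])
    gcongr
  have hbound : ∀ᶠ n : ℕ in atTop, ∫ ζ in N n, (‖a ζ‖ ^ 2 - 2 * (a ζ * conj (s ζ)).re) ≤
      4 * Real.pi * η + 2 * Real.pi * (Real.log ‖E 0‖ - Real.log ‖E w‖) -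
        Real.pi * Real.log (1 - ‖w‖ ^ 2) := by
    filter_upwards [eventually_norm_div_dslope_mem hR hf hinj hf0 hw hE hEd hE0 hη, hxy,
      eventually_gt_atTop 0] with n hn hxy hn0
    have hn0' : (0 : ℝ) < n := Nat.cast_pos.2 hn0
    have hx : 0 < Real.exp (-n - η) / ‖E 0‖ := by positivity
    have hexp : Real.exp (-n) < Real.exp n := Real.exp_lt_exp.2 (by linarith)
    have hQ := setLIntegral_norm_logDeriv_sq_le (hNm n) (hderiv n) (hTinj n) hx hxy hn
    have hQ0 : 0 ≤ 2 * Real.pi * Real.log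
        (Real.exp (n + η) / ‖E w‖ / (Real.exp (-n - η) / ‖E 0‖)) :=
      mul_nonneg (by positivity) (Real.log_nonneg ((one_le_div hx).2 hxy.le))
    have hS := ofReal_le_setLIntegral_inter_ball hw hw0 (Real.exp_pos _) hexp
    have hfin : ∫⁻ ζ in N n, ENNReal.ofReal (‖s ζ‖ ^ 2) ≠ ⊤ := by
      refine ne_top_of_le_ne_top ?_ (lintegral_mono_set inter_subset_left)
      rw [setLIntegral_norm_inv_sub_inv_sq hw0 (Real.exp_pos _) hexp]
      exact ENNReal.ofReal_ne_top
    have ham : AEStronglyMeasurable a (volume.restrict (N n)) :=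
      (ha.continuousOn.mono (inter_subset_right.trans
        (ball_subset_closedBall.trans hsub))).aestronglyMeasurable (hNm n)
    have key := setIntegral_sub_norm_sq_le (hsm.aestronglyMeasurable.sub ham)
      hsm.aestronglyMeasurable hQ0 hQ hS hfin
    have hpt : ∀ ζ, ‖(s - a) ζ‖ ^ 2 - ‖s ζ‖ ^ 2 = ‖a ζ‖ ^ 2 - 2 * (a ζ * conj (s ζ)).re := by
      intro ζ
      simp only [Pi.sub_apply, ← Complex.normSq_eq_norm_sq, Complex.normSq_apply, Complex.mul_re,
        Complex.sub_re, Complex.sub_im, Complex.conj_re, Complex.conj_im]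
      ring
    simp only [hpt] at key
    refine key.trans (le_of_eq ?_)
    rw [Real.log_div (by positivity) (by positivity), Real.log_div (by positivity) hEw.ne',
      Real.log_div (by positivity) hEz.ne', Real.log_div (by positivity) (by positivity)]
    simp only [Real.log_exp]
    ring
  have := le_of_tendsto hlim hbound
  linarith

theorem log_norm_dslope_div_dslope_ge {R : ℝ} (hR : 1 < R) {f : ℂ → ℂ}
    (hf : DifferentiableOn ℂ f (ball 0 R)) (hinj : InjOn f (ball 0 R)) (hf0 : f 0 = 0)
    {w : ℂ} (hw : ‖w‖ < 1) (hw0 : w ≠ 0) {z : ℂ} (hz : ‖z‖ < 1)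
    {E : ℂ → ℂ} (hE : ∀ ζ, E ζ = dslope f w ζ / dslope f 0 ζ)
    (hEd : DifferentiableOn ℂ E (ball 0 R)) (hE0 : ∀ ζ ∈ ball (0 : ℂ) R, E ζ ≠ 0) :
    (Real.log (1 - ‖z‖ ^ 2) + Real.log (1 - ‖w‖ ^ 2)) / 2 ≤
      Real.log ‖E z‖ - Real.log ‖E 0‖ := by
  have hsub : closedBall (0 : ℂ) 1 ⊆ ball 0 R := closedBall_subset_ball hR
  have hzR : z ∈ ball (0 : ℂ) R := by simpa using hz.trans hR
  have h0R : (0 : ℂ) ∈ ball (0 : ℂ) R := by simpa using one_pos.trans hR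
  obtain ⟨A, hA, hAE⟩ := exists_exp_eq_of_differentiableOn_ball hEd hE0
  have hAre : ∀ ζ ∈ ball (0 : ℂ) R, (A ζ).re = Real.log ‖E ζ‖ := fun ζ hζ => by
    rw [← hAE ζ hζ, Complex.norm_exp, Real.log_exp]
  have harea := setIntegral_norm_logDeriv_dslope_sq_le hR hf hinj hf0 hw hw0 hE hEd hE0
  set a : ℂ → ℂ := fun ζ => deriv E ζ / E ζ with ha_def
  have ha : DifferentiableOn ℂ a (ball 0 R) := (hEd.deriv isOpen_ball).fun_div hEd hE0
  set κ : ℂ → ℂ := fun ζ => conj z / (1 - conj z * ζ) with hκ_def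
  have hac : ContinuousOn a (closedBall 0 1) := ha.continuousOn.mono hsub
  have hκc : ContinuousOn κ (closedBall 0 1) := by
    refine continuousOn_const.div (by fun_prop) fun ζ hζ h => ?_
    have h1 : ‖conj z * ζ‖ = 1 := by rw [← sub_eq_zero.1 h, norm_one]
    rw [norm_mul, RCLike.norm_conj] at h1
    have : ‖ζ‖ ≤ 1 := by simpa using hζ
    nlinarith [norm_nonneg ζ, norm_nonneg z]
  have hint : ∀ {F : Type} [NormedAddCommGroup F] {g : ℂ → F},
      ContinuousOn g (closedBall 0 1) → IntegrableOn g (ball 0 1) := fun hg =>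
    (hg.integrableOn_compact (isCompact_closedBall 0 1)).mono_set ball_subset_closedBall
  have haint : IntegrableOn (fun ζ => ‖a ζ‖ ^ 2) (ball 0 1) := hint (hac.norm.pow 2)
  have hκint : IntegrableOn (fun ζ => ‖κ ζ‖ ^ 2) (ball 0 1) := hint (hκc.norm.pow 2)
  have haκint : IntegrableOn (fun ζ => a ζ * conj (κ ζ)) (ball 0 1) :=
    hint (hac.fun_mul (Complex.continuous_conj.comp_continuousOn hκc))
  have hreint : IntegrableOn (fun ζ => 2 * (a ζ * conj (κ ζ)).re) (ball 0 1) :=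
    haκint.re.const_mul 2
  have hcross : ∫ ζ in ball (0 : ℂ) 1, (a ζ * conj (κ ζ)).re =
      Real.pi * (Real.log ‖E z‖ - Real.log ‖E 0‖) := by
    refine (integral_re haκint).trans ?_
    rw [setIntegral_mul_conj_szego hR hA ha hz, ← hAre z hzR, ← hAre 0 h0R]
    simp
  have hκval : ∫ ζ in ball (0 : ℂ) 1, ‖κ ζ‖ ^ 2 = -Real.pi * Real.log (1 - ‖z‖ ^ 2) := by
    rw [setIntegral_norm_szego_sq (by simpa using hz), RCLike.norm_conj]
  have hnonneg : 0 ≤ ∫ ζ in ball (0 : ℂ) 1,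
      (‖a ζ‖ ^ 2 + 2 * (a ζ * conj (κ ζ)).re + ‖κ ζ‖ ^ 2) := by
    refine integral_nonneg fun ζ => ?_
    have : ‖a ζ‖ ^ 2 + 2 * (a ζ * conj (κ ζ)).re + ‖κ ζ‖ ^ 2 = ‖a ζ + κ ζ‖ ^ 2 := by
      simp only [← Complex.normSq_eq_norm_sq, Complex.normSq_apply, Complex.mul_re,
        Complex.add_re, Complex.add_im, Complex.conj_re, Complex.conj_im]
      ring
    rw [this]
    exact sq_nonneg _
  rw [integral_add (by exact haint.add hreint) hκint, integral_add haint hreint, integral_const_mul, hcross,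
    hκval] at hnonneg
  refine le_of_mul_le_mul_left ?_ (mul_pos two_pos Real.pi_pos)
  linarith

theorem norm_mul_norm_mul_sqrt_le_of_lt_radius {R : ℝ} (hR : 1 < R) {f : ℂ → ℂ}
    (hf : DifferentiableOn ℂ f (ball 0 R)) (hinj : InjOn f (ball 0 R)) (hf0 : f 0 = 0)
    (hf' : ∀ ζ ∈ ball (0 : ℂ) R, deriv f ζ ≠ 0) {z w : ℂ} (hz : ‖z‖ < 1) (hw : ‖w‖ < 1) :
    ‖f z‖ * ‖f w‖ * ‖z - w‖ * √((1 - ‖z‖ ^ 2) * (1 - ‖w‖ ^ 2)) ≤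
      ‖f z - f w‖ * ‖z‖ * ‖w‖ * ‖deriv f 0‖ := by
  rcases eq_or_ne z 0 with rfl | hz0
  · simp [hf0]
  rcases eq_or_ne w 0 with rfl | hw0
  · simp [hf0]
  rcases eq_or_ne z w with rfl | hzw
  · simp
  have hzR : z ∈ ball (0 : ℂ) R := by simpa using hz.trans hR
  have hwR : w ∈ ball (0 : ℂ) R := by simpa using hw.trans hR
  have h0R : (0 : ℂ) ∈ ball (0 : ℂ) R := by simpa using one_pos.trans hR
  have hds : ∀ c ∈ ball (0 : ℂ) R, DifferentiableOn ℂ (dslope f c) (ball 0 R) := fun c hc =>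
    (Complex.differentiableOn_dslope (isOpen_ball.mem_nhds hc)).2 hf
  have hne : ∀ c ∈ ball (0 : ℂ) R, ∀ ζ ∈ ball (0 : ℂ) R, dslope f c ζ ≠ 0 := fun c hc ζ hζ =>
    dslope_ne_zero_of_injOn hinj hf' hc hζ
  have hE0 : ∀ ζ ∈ ball (0 : ℂ) R, dslope f w ζ / dslope f 0 ζ ≠ 0 := fun ζ hζ =>
    div_ne_zero (hne w hwR ζ hζ) (hne 0 h0R ζ hζ)
  have key := log_norm_dslope_div_dslope_ge hR hf hinj hf0 hw hw0 hz (fun ζ => rfl)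
    ((hds w hwR).fun_div (hds 0 h0R) (hne 0 h0R)) hE0
  have hz2 : 0 < 1 - ‖z‖ ^ 2 := by nlinarith [norm_nonneg z]
  have hw2 : 0 < 1 - ‖w‖ ^ 2 := by nlinarith [norm_nonneg w]
  rw [← Real.log_mul hz2.ne' hw2.ne', ← Real.log_sqrt (mul_pos hz2 hw2).le,
    ← Real.log_div (norm_ne_zero_iff.2 (hE0 z hzR)) (norm_ne_zero_iff.2 (hE0 0 h0R)),
    Real.log_le_log_iff (by positivity)
      (div_pos (norm_pos_iff.2 (hE0 z hzR)) (norm_pos_iff.2 (hE0 0 h0R)))] at key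
  rw [dslope_of_ne _ hz0, dslope_of_ne _ hzw, dslope_of_ne _ hw0.symm, dslope_same,
    slope_def_field, slope_def_field, slope_def_field, hf0] at key
  have hfz : f z ≠ 0 := fun h => hz0 (hinj hzR h0R (h.trans hf0.symm))
  have hfw : f w ≠ 0 := fun h => hw0 (hinj hwR h0R (h.trans hf0.symm))
  have h1 : 0 < ‖f z‖ := norm_pos_iff.2 hfz
  have h2 : 0 < ‖f w‖ := norm_pos_iff.2 hfw
  have h3 : 0 < ‖z‖ := norm_pos_iff.2 hz0
  have h4 : 0 < ‖w‖ := norm_pos_iff.2 hw0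
  have h5 : 0 < ‖z - w‖ := norm_pos_iff.2 (sub_ne_zero.2 hzw)
  have h6 : 0 < ‖deriv f 0‖ := norm_pos_iff.2 (hf' 0 h0R)
  simp only [norm_div, sub_zero, zero_sub, norm_neg] at key
  rw [show ‖f z - f w‖ / ‖z - w‖ / (‖f z‖ / ‖z‖) / (‖f w‖ / ‖w‖ / ‖deriv f 0‖) =
    ‖f z - f w‖ * ‖z‖ * ‖w‖ * ‖deriv f 0‖ / (‖f z‖ * ‖f w‖ * ‖z - w‖) by field_simp,
    le_div_iff₀ (by positivity)] at key
  linarith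

theorem norm_mul_norm_mul_sqrt_le_of_injOn {f : ℂ → ℂ} (hf : DifferentiableOn ℂ f (ball 0 1))
    (hinj : InjOn f (ball 0 1)) (hf0 : f 0 = 0) (hf' : ∀ ζ ∈ ball (0 : ℂ) 1, deriv f ζ ≠ 0)
    {z w : ℂ} (hz : ‖z‖ < 1) (hw : ‖w‖ < 1) :
    ‖f z‖ * ‖f w‖ * ‖z - w‖ * √((1 - ‖z‖ ^ 2) * (1 - ‖w‖ ^ 2)) ≤
      ‖f z - f w‖ * ‖z‖ * ‖w‖ * ‖deriv f 0‖ := by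
  have hscale : ∀ᶠ t : ℝ in 𝓝[<] 1, ‖f z‖ * ‖f w‖ * ‖z / t - w / t‖ *
      √((1 - ‖z / t‖ ^ 2) * (1 - ‖w / t‖ ^ 2)) ≤
        ‖f z - f w‖ * ‖z / t‖ * ‖w / t‖ * ‖t * deriv f 0‖ := by
    filter_upwards [self_mem_nhdsWithin, mem_nhdsWithin_of_mem_nhds (lt_mem_nhds hz),
      mem_nhdsWithin_of_mem_nhds (lt_mem_nhds hw),
      mem_nhdsWithin_of_mem_nhds (lt_mem_nhds one_pos)] with t ht hzt hwt ht0
    have ht0' : (t : ℂ) ≠ 0 := Complex.ofReal_ne_zero.2 (ne_of_gt ht0)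
    have hnorm : ∀ ζ : ℂ, ‖(t : ℂ) * ζ‖ = t * ‖ζ‖ := fun ζ => by
      rw [norm_mul, Complex.norm_real, Real.norm_of_nonneg (le_of_lt ht0)]
    have hmaps : MapsTo (fun ζ : ℂ => (t : ℂ) * ζ) (ball 0 t⁻¹) (ball 0 1) := by
      intro ζ hζ
      have h : ‖ζ‖ < t⁻¹ := by simpa using hζ
      rw [mem_ball_zero_iff, hnorm]
      calc t * ‖ζ‖ < t * t⁻¹ := by gcongr
        _ = 1 := mul_inv_cancel₀ (ne_of_gt ht0)
    have hderiv : ∀ ζ ∈ ball (0 : ℂ) t⁻¹,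
        HasDerivAt (fun ζ : ℂ => f (t * ζ)) (t * deriv f (t * ζ)) ζ := by
      intro ζ hζ
      have h1 := (hf.differentiableAt (isOpen_ball.mem_nhds (hmaps hζ))).hasDerivAt
      have h2 : HasDerivAt (fun ζ : ℂ => (t : ℂ) * ζ) t ζ := by
        simpa using (hasDerivAt_id ζ).const_mul (t : ℂ)
      exact (h1.comp ζ h2).congr_deriv (mul_comm _ _)
    have hlt : ∀ {ζ : ℂ}, ‖ζ‖ < t → ‖ζ / t‖ < 1 := fun {ζ} hζ => by
      rw [norm_div, Complex.norm_real, Real.norm_of_nonneg (le_of_lt ht0), div_lt_one ht0]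
      exact hζ
    have h0 : (0 : ℂ) ∈ ball (0 : ℂ) t⁻¹ := by simpa using ht0
    have key := norm_mul_norm_mul_sqrt_le_of_lt_radius ((one_lt_inv₀ ht0).2 ht)
      (f := fun ζ => f (t * ζ)) (z := z / t) (w := w / t)
      (fun ζ hζ => (hderiv ζ hζ).differentiableAt.differentiableWithinAt)
      (fun ζ hζ ξ hξ h => mul_left_cancel₀ ht0' (hinj (hmaps hζ) (hmaps hξ) h))
      (by simpa using hf0)
      (fun ζ hζ => by
        rw [(hderiv ζ hζ).deriv]
        exact mul_ne_zero ht0' (hf' _ (hmaps hζ)))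
      (hlt hzt) (hlt hwt)
    rw [(hderiv 0 h0).deriv] at key
    simpa only [mul_div_cancel₀ _ ht0', mul_zero] using key
  have hdiv : ∀ ζ : ℂ, Tendsto (fun t : ℝ => ζ / t) (𝓝[<] 1) (𝓝 ζ) := fun ζ => by
    have h : ContinuousAt (fun t : ℝ => ζ / t) 1 :=
      continuousAt_const.div Complex.continuous_ofReal.continuousAt (by simp)
    simpa using h.tendsto.mono_left nhdsWithin_le_nhds
  have hmul : Tendsto (fun t : ℝ => (t : ℂ) * deriv f 0) (𝓝[<] 1) (𝓝 (deriv f 0)) := by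
    have h : ContinuousAt (fun t : ℝ => (t : ℂ) * deriv f 0) 1 := by fun_prop
    simpa using h.tendsto.mono_left nhdsWithin_le_nhds
  refine le_of_tendsto_of_tendsto ?_ ?_ hscale
  · refine Tendsto.mul (tendsto_const_nhds.mul ((hdiv z).sub (hdiv w)).norm)
      (Real.continuous_sqrt.continuousAt.tendsto.comp ?_)
    exact (((hdiv z).norm.pow 2).const_sub 1).mul (((hdiv w).norm.pow 2).const_sub 1)
  · exact ((tendsto_const_nhds.mul (hdiv z).norm).mul (hdiv w).norm).mul hmul.norm

theorem differentiableAt_leftInverse_of_injOn {U : Set ℂ} (hU : IsOpen U) {φ g : ℂ → ℂ}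
    (hφ : DifferentiableOn ℂ φ U) (hinj : InjOn φ U) (hg : ∀ x ∈ U, g (φ x) = x) {x : ℂ}
    (hx : x ∈ U) : DifferentiableAt ℂ g (φ x) ∧ deriv g (φ x) * deriv φ x = 1 := by
  have han : ∀ x ∈ U, AnalyticAt ℂ φ x := fun x hx => hφ.analyticAt (hU.mem_nhds hx)
  have hnconst : ∀ x ∈ U, ¬ ∀ᶠ y in 𝓝 x, φ y = φ x := by
    intro x hx h
    have h1 : ∀ᶠ y in 𝓝[≠] x, y = x := by
      filter_upwards [nhdsWithin_le_nhds h, nhdsWithin_le_nhds (hU.mem_nhds hx)] with y hy hyU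
      exact hinj hyU hx hy
    obtain ⟨y, hy, hyx⟩ := (h1.and self_mem_nhdsWithin).exists
    exact hyx hy
  have hnhds : ∀ x ∈ U, 𝓝 (φ x) ≤ map φ (𝓝 x) := fun x hx =>
    (han x hx).eventually_constant_or_nhds_le_map_nhds.resolve_left (hnconst x hx)
  have hcont : ∀ x ∈ U, ContinuousAt g (φ x) := by
    intro x hx
    have h1 : Tendsto (g ∘ φ) (𝓝 x) (𝓝 (g (φ x))) := by
      rw [hg x hx]
      refine tendsto_id.congr' ?_
      filter_upwards [hU.mem_nhds hx] with y hy
      exact (hg y hy).symm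
    exact (tendsto_map'_iff.2 h1).mono_left (hnhds x hx)
  have himage : ∀ x ∈ U, ∀ᶠ y in 𝓝 (φ x), g y ∈ U ∧ φ (g y) = y := by
    intro x hx
    refine hnhds x hx (mem_map.2 ?_)
    filter_upwards [hU.mem_nhds hx] with y hy
    change g (φ y) ∈ U ∧ φ (g (φ y)) = φ y
    rw [hg y hy]
    exact ⟨hy, rfl⟩
  have hderiv : ∀ᶠ y in 𝓝[≠] x, deriv φ y ≠ 0 := by
    refine (han x hx).deriv.eventually_eq_zero_or_eventually_ne_zero.resolve_left fun h => ?_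
    obtain ⟨r, hr, hball⟩ := Metric.eventually_nhds_iff_ball.1 (h.and (hU.mem_nhds hx))
    refine hnconst x hx ?_
    filter_upwards [ball_mem_nhds x hr] with y hy
    exact isOpen_ball.is_const_of_deriv_eq_zero (convex_ball x r).isPreconnected
      (hφ.mono fun y hy => (hball y hy).2) (fun y hy => (hball y hy).1) hy (mem_ball_self hr)
  have hdiff : DifferentiableAt ℂ g (φ x) := by
    refine (Complex.analyticAt_of_differentiable_on_punctured_nhds_of_continuousAt ?_
      (hcont x hx)).differentiableAt
    have htend : Tendsto g (𝓝[≠] φ x) (𝓝[≠] x) := by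
      refine tendsto_nhdsWithin_iff.2 ⟨?_, ?_⟩
      · have := (hcont x hx).tendsto
        rw [hg x hx] at this
        exact this.mono_left nhdsWithin_le_nhds
      · filter_upwards [self_mem_nhdsWithin, nhdsWithin_le_nhds (himage x hx)] with y hy hy'
        intro h
        refine hy ?_
        rw [mem_singleton_iff] at h ⊢
        rw [← hy'.2, h]
    filter_upwards [htend.eventually hderiv, nhdsWithin_le_nhds (himage x hx).eventually_nhds]
      with y hy hy'
    obtain ⟨hyU, hyφ⟩ := hy'.self_of_nhds
    have hgy : ContinuousAt g y := by
      have := hcont (g y) hyU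
      rwa [hyφ] at this
    exact ((hφ.differentiableAt (hU.mem_nhds hyU)).hasDerivAt.of_local_left_inverse hgy hy
      (hy'.mono fun _ h => h.2)).differentiableAt
  refine ⟨hdiff, ?_⟩
  have hcomp := hdiff.hasDerivAt.comp x (hφ.differentiableAt (hU.mem_nhds hx)).hasDerivAt
  refine hcomp.unique ((hasDerivAt_id x).congr_of_eventuallyEq ?_)
  filter_upwards [hU.mem_nhds hx] with y hy
  exact hg y hy

theorem norm_sq_sub_one_lt_one_of_norm_add_le {u : ℂ} (hu : ‖u + 4 / 5‖ ≤ 12 / 25) :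
    u.re < 0 ∧ ‖u ^ 2 - 1‖ < 1 := by
  have hu2 : ‖u + 4 / 5‖ ^ 2 ≤ (12 / 25) ^ 2 := by gcongr
  rw [← Complex.normSq_eq_norm_sq, Complex.normSq_apply] at hu2
  have h45 : (4 / 5 : ℂ) = ((4 / 5 : ℝ) : ℂ) := by norm_num
  simp only [h45, Complex.add_re, Complex.add_im, Complex.ofReal_re, Complex.ofReal_im,
    add_zero] at hu2
  have hre : u.re < 0 := by nlinarith [mul_self_nonneg u.im]
  refine ⟨hre, ?_⟩
  refine lt_of_pow_lt_pow_left₀ 2 zero_le_one ?_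
  have hfac : u ^ 2 - 1 = (u - 1) * (u + 1) := by ring
  rw [hfac, norm_mul, mul_pow, ← Complex.normSq_eq_norm_sq, ← Complex.normSq_eq_norm_sq,
    Complex.normSq_apply, Complex.normSq_apply]
  simp only [Complex.sub_re, Complex.sub_im, Complex.add_re, Complex.add_im, Complex.one_re,
    Complex.one_im, sub_zero, add_zero]
  obtain ⟨X, hX⟩ : ∃ X, X = u.re + 4 / 5 := ⟨_, rfl⟩
  have hux : u.re = X - 4 / 5 := by linarith
  rw [hux] at hu2 ⊢
  have h1 : (X - 4 / 5 - 1) * (X - 4 / 5 - 1) + u.im * u.im ≤ (3.4704 - 3.6 * X) := by nlinarith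
  have h2 : (X - 4 / 5 + 1) * (X - 4 / 5 + 1) + u.im * u.im ≤ (0.2704 + 0.4 * X) := by nlinarith
  have h3 := mul_le_mul h1 h2 (add_nonneg (mul_self_nonneg _) (mul_self_nonneg _))
    ((add_nonneg (mul_self_nonneg _) (mul_self_nonneg _)).trans h1)
  refine h3.trans_lt ?_
  nlinarith [sq_nonneg (X - 0.144)]

theorem norm_deriv_zero_le_of_notMem_image {f φ : ℂ → ℂ} (hf : DifferentiableOn ℂ f (ball 0 1))
    (hf0 : f 0 = 0) {p : ℂ} (hp0 : p ≠ 0) (hp : ∀ ζ ∈ ball (0 : ℂ) 1, f ζ ≠ p)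
    (hφc : ContinuousOn φ (ball 0 ‖p‖)) (hφm : MapsTo φ (ball 0 ‖p‖) (ball 0 1))
    (hφf : ∀ ζ ∈ ball (0 : ℂ) 1, φ (f ζ) = ζ) (hfφ : ∀ x ∈ ball (0 : ℂ) ‖p‖, f (φ x) = x) :
    ‖deriv f 0‖ ≤ 55 / 4 * ‖p‖ := by
  have h0 : (0 : ℂ) ∈ ball (0 : ℂ) 1 := by simp
  have hppos : 0 < ‖p‖ := norm_pos_iff.2 hp0
  have hEd : DifferentiableOn ℂ (fun ζ => 1 - f ζ / p) (ball 0 1) :=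
    (hf.div_const p).const_sub 1
  obtain ⟨A, hA, hAE⟩ := exists_exp_eq_of_differentiableOn_ball hEd fun ζ hζ h => hp ζ hζ
    ((div_eq_one_iff_eq hp0).1 (sub_eq_zero.1 h).symm)
  have hA0 : Complex.exp (A 0) = 1 := by simpa [hf0] using hAE 0 h0
  set h : ℂ → ℂ := fun ζ => Complex.exp ((A ζ - A 0) / 2) with h_def
  have hh0 : h 0 = 1 := by simp [h_def]
  have hsq : ∀ ζ ∈ ball (0 : ℂ) 1, h ζ ^ 2 = 1 - f ζ / p := by
    intro ζ hζ
    rw [h_def, ← Complex.exp_nat_mul, Nat.cast_ofNat, mul_div_cancel₀ _ two_ne_zero,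
      Complex.exp_sub, hA0, div_one, hAE ζ hζ]
  have hhd : ∀ ζ ∈ ball (0 : ℂ) 1, DifferentiableAt ℂ h ζ := fun ζ hζ =>
    (((hA ζ hζ).differentiableAt.sub_const _).div_const _).cexp
  have hh' : HasDerivAt h (-(deriv f 0 / p / 2)) 0 := by
    have h1 : HasDerivAt (fun ζ => 1 - f ζ / p) (-(deriv f 0 / p)) 0 :=
      ((hf.differentiableAt (isOpen_ball.mem_nhds h0)).hasDerivAt.div_const p).const_sub 1
    refine (((hA 0 h0).sub_const (A 0)).div_const 2).cexp.congr_deriv ?_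
    rw [h1.deriv]
    simp [hf0, neg_div]
  have havoid : ∀ ζ ∈ ball (0 : ℂ) 1, 12 / 25 < ‖h ζ + 4 / 5‖ := by
    intro ζ hζ
    by_contra! hcon
    obtain ⟨hre, hlt⟩ := norm_sq_sub_one_lt_one_of_norm_add_le hcon
    rw [hsq ζ hζ, sub_sub_cancel_left, norm_neg, norm_div, div_lt_one hppos] at hlt
    have hkc : ContinuousOn (fun x => (h (φ x)).re) (ball 0 ‖p‖) :=
      Complex.continuous_re.comp_continuousOn (ContinuousOn.comp (g := h)
        (fun ζ hζ => (hhd ζ hζ).continuousAt.continuousWithinAt) hφc hφm)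
    have hfζ : f ζ ∈ ball (0 : ℂ) ‖p‖ := by simpa using hlt
    have h0p : (0 : ℂ) ∈ ball (0 : ℂ) ‖p‖ := by simpa using hp0
    have hφ0 : φ 0 = 0 := by simpa [hf0] using hφf 0 h0
    obtain ⟨x, hx, hx0⟩ := (convex_ball (0 : ℂ) ‖p‖).isPreconnected.intermediate_value hfζ h0p hkc
      (show (0 : ℝ) ∈ Icc _ _ by
        constructor
        · simpa only [hφf ζ hζ] using hre.le
        · simp [hφ0, hh0])
    have hxsq := congrArg Complex.re (hsq (φ x) (hφm hx))
    rw [hfφ x hx] at hxsq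
    simp only [pow_two, Complex.mul_re, hx0, Complex.sub_re, Complex.one_re] at hxsq
    have h1 : (x / p).re < 1 := by
      refine (Complex.re_le_norm _).trans_lt ?_
      rw [norm_div, div_lt_one hppos]
      simpa using hx
    nlinarith [mul_self_nonneg (h (φ x)).im]
  have hne : ∀ ζ ∈ ball (0 : ℂ) 1, h ζ + 4 / 5 ≠ 0 := fun ζ hζ =>
    norm_pos_iff.1 ((by norm_num : (0 : ℝ) < 12 / 25).trans (havoid ζ hζ))
  have hsub : closedBall (0 : ℂ) (54 / 55) ⊆ ball 0 1 := closedBall_subset_ball (by norm_num)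
  have hcauchy := Complex.norm_deriv_le_of_forall_mem_sphere_norm_le (c := 0) (R := 54 / 55)
    (C := 25 / 12) (f := fun ζ => (h ζ + 4 / 5)⁻¹) (by norm_num)
    (DifferentiableOn.diffContOnCl_ball (U := ball 0 1)
      (fun ζ hζ => (((hhd ζ hζ).add_const _).fun_inv (hne ζ hζ)).differentiableWithinAt) hsub)
    (fun ζ hζ => by
      rw [norm_inv]
      refine inv_le_of_inv_le₀ (by norm_num) ?_
      rw [inv_div]
      exact (havoid ζ (hsub (sphere_subset_closedBall hζ))).le)
  rw [((hh'.add_const (4 / 5)).fun_inv (hne 0 h0)).deriv, hh0] at hcauchy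
  rw [neg_neg, norm_div, norm_div, norm_div] at hcauchy
  norm_num at hcauchy
  rw [div_div, div_div, div_le_iff₀ (by positivity)] at hcauchy
  linarith

theorem mul_mul_div_eight_le_of_mul_le {ρ a b c d e m n δ : ℝ} (hρ : 0 < ρ) (hd : 0 ≤ d)
    (hm : 0 < m) (hn : 0 < n) (he : 0 ≤ e) (hδ : 0 < δ) (hδ1 : δ < 1) (hmδ : m ≤ 1 - δ)
    (hnδ : n ≤ 1 - δ) (ha : 3 / 4 * ρ ≤ a) (hb : 3 / 4 * ρ ≤ b) (ham : ρ * m ≤ a) (hbn : ρ * n ≤ b)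
    (hc : c ≤ 55 / 4 * ρ) (h : a * b * d * √((1 - m ^ 2) * (1 - n ^ 2)) ≤ e * m * n * c) :
    ρ * δ * d / 8 ≤ e := by
  obtain ⟨r, hr⟩ : ∃ r, r = 1 - δ := ⟨_, rfl⟩
  obtain rfl : δ = 1 - r := by linarith
  rw [sub_sub_cancel] at hmδ hnδ
  have hr0 : 0 < r := hm.trans_le hmδ
  have hr2 : 0 ≤ 1 - r ^ 2 := by nlinarith
  have hsqrt : 1 - r ^ 2 ≤ √((1 - m ^ 2) * (1 - n ^ 2)) := by
    refine Real.le_sqrt_of_sq_le ?_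
    rw [pow_two]
    gcongr
    nlinarith
  have ha0 : 0 < a := (by positivity : 0 < 3 / 4 * ρ).trans_le ha
  have hb0 : 0 < b := (by positivity : 0 < 3 / 4 * ρ).trans_le hb
  have key : a * b * (d * (1 - r ^ 2)) ≤ e * (m * n) * (55 / 4 * ρ) :=
    calc a * b * (d * (1 - r ^ 2)) = a * b * d * (1 - r ^ 2) := by ring
      _ ≤ a * b * d * √((1 - m ^ 2) * (1 - n ^ 2)) := by gcongr
      _ ≤ e * m * n * c := h
      _ = e * (m * n) * c := by ring
      _ ≤ _ := by gcongr
  have hd' : 0 ≤ d * (1 - r ^ 2) := mul_nonneg hd hr2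
  have hfactor : 0 ≤ ρ * ((1 - r) * d) := by positivity
  rcases le_or_gt (23 / 32) r with hr1 | hr1
  · have h1 : (ρ * (m * n)) * (ρ * (d * (1 - r ^ 2))) ≤ (ρ * (m * n)) * (55 / 4 * e) :=
      calc (ρ * (m * n)) * (ρ * (d * (1 - r ^ 2))) = (ρ * m) * (ρ * n) * (d * (1 - r ^ 2)) := by
            ring
        _ ≤ a * b * (d * (1 - r ^ 2)) := by gcongr
        _ ≤ _ := key
        _ = _ := by ring
    have h2 := le_of_mul_le_mul_left h1 (by positivity)
    have h3 := mul_le_mul_of_nonneg_left hr1 hfactor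
    nlinarith
  · have h1 : ρ * (9 / 16 * ρ * (d * (1 - r ^ 2))) ≤ ρ * (55 / 4 * e * r ^ 2) :=
      calc ρ * (9 / 16 * ρ * (d * (1 - r ^ 2))) =
            (3 / 4 * ρ) * (3 / 4 * ρ) * (d * (1 - r ^ 2)) := by ring
        _ ≤ a * b * (d * (1 - r ^ 2)) := by gcongr
        _ ≤ _ := key
        _ ≤ e * (r * r) * (55 / 4 * ρ) := by gcongr
        _ = _ := by ring
    have h2 := le_of_mul_le_mul_left h1 hρ
    have h3 : 55 / 32 * r ^ 2 ≤ 9 / 16 * (1 + r) := by nlinarith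
    have h4 := mul_le_mul_of_nonneg_left h3 hfactor
    refine le_of_mul_le_mul_left ?_ (by positivity : 0 < 55 / 4 * r ^ 2)
    nlinarith

theorem mul_norm_sub_div_eight_le_of_mapsTo_ball {φ : ℂ → ℂ} {o x y : ℂ} {ρ : ℝ} (hρ : 0 < ρ)
    (hφ : DifferentiableOn ℂ φ (ball o ρ)) (hmaps : MapsTo φ (ball o ρ) (ball 0 1))
    (hx : ‖x - o‖ ≤ 3 / 4 * ρ) (hy : φ y ∈ ball (0 : ℂ) 1) :
    ρ * ‖φ x - φ y‖ / 8 ≤ ‖x - y‖ := by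
  have hsub : ball x (ρ / 4) ⊆ ball o ρ := ball_subset_ball' (by rw [dist_eq_norm]; linarith)
  have hx1 : φ x ∈ ball (0 : ℂ) 1 := hmaps (hsub (mem_ball_self (by positivity)))
  have htwo : ∀ ζ ∈ ball (0 : ℂ) 1, ‖ζ - φ x‖ ≤ 2 := by
    intro ζ hζ
    rw [mem_ball_zero_iff] at hζ hx1
    exact (norm_sub_le _ _).trans (by linarith)
  rcases lt_or_ge (dist y x) (ρ / 4) with h | h
  · have key := Complex.dist_le_div_mul_dist_of_mapsTo_ball (R₂ := 2) (hφ.mono hsub)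
      (fun ζ hζ => by simpa [dist_eq_norm] using htwo _ (hmaps (hsub hζ))) (mem_ball.2 h)
    rw [dist_eq_norm, dist_eq_norm, norm_sub_rev, norm_sub_rev y, div_mul_eq_mul_div,
      le_div_iff₀ (by positivity)] at key
    linarith
  · rw [dist_eq_norm, norm_sub_rev] at h
    have h2 := htwo _ hy
    rw [norm_sub_rev] at h2
    nlinarith

theorem infDist_mul_norm_sub_le {D : Set ℂ} (hD : IsOpen D) {o : ℂ} (ho : o ∈ D) {φ : ℂ → ℂ}
    (hφ : DifferentiableOn ℂ φ D) (hbij : BijOn φ D (ball 0 1)) (hφo : φ o = 0) {δ : ℝ}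
    (hδ : 0 < δ) (hδ1 : δ < 1) {x y : ℂ} (hx : x ∈ D) (hy : y ∈ D) (hxδ : ‖φ x‖ < 1 - δ)
    (hyδ : ‖φ y‖ < 1 - δ) : infDist o Dᶜ * δ * ‖φ x - φ y‖ / 8 ≤ ‖x - y‖ := by
  rcases (infDist_nonneg (x := o) (s := Dᶜ)).eq_or_lt with hρ | hρ
  · rw [← hρ]
    simp
  have hDc : (Dᶜ).Nonempty := by
    by_contra h
    rw [not_nonempty_iff_eq_empty.1 h, infDist_empty] at hρ
    exact hρ.false
  obtain ⟨p, hp, hpdist⟩ := hD.isClosed_compl.exists_infDist_eq_dist hDc o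
  set ρ := infDist o Dᶜ with hρ_def
  have hball : ball o ρ ⊆ D := by
    intro z hz
    by_contra h
    have h1 := infDist_le_dist_of_mem (x := o) (show z ∈ Dᶜ from h)
    rw [dist_comm] at h1
    exact (mem_ball.1 hz).not_ge h1
  set f : ℂ → ℂ := fun ζ => Function.invFunOn φ D ζ - o with hf_def
  have hleft : ∀ x ∈ D, f (φ x) = x - o := fun x hx => by
    rw [hf_def]
    simp only [hbij.injOn.leftInvOn_invFunOn hx]
  have hf0 : f 0 = 0 := by
    have h := hleft o ho
    rwa [hφo, sub_self] at h
  have hfdiff : ∀ ζ ∈ ball (0 : ℂ) 1, DifferentiableAt ℂ f ζ ∧ deriv f ζ ≠ 0 := by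
    intro ζ hζ
    obtain ⟨x, hx, rfl⟩ := hbij.surjOn hζ
    obtain ⟨h1, h2⟩ := differentiableAt_leftInverse_of_injOn hD hφ hbij.injOn
      (g := Function.invFunOn φ D) (fun x hx => hbij.injOn.leftInvOn_invFunOn hx) hx
    refine ⟨h1.sub_const o, ?_⟩
    rw [hf_def, deriv_sub_const]
    exact left_ne_zero_of_mul_eq_one h2
  have hfd : DifferentiableOn ℂ f (ball 0 1) := fun ζ hζ => (hfdiff ζ hζ).1.differentiableWithinAt
  have hright : ∀ ζ ∈ ball (0 : ℂ) 1, f ζ + o ∈ D ∧ φ (f ζ + o) = ζ := by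
    intro ζ hζ
    obtain ⟨x, hx, rfl⟩ := hbij.surjOn hζ
    rw [hleft x hx, sub_add_cancel]
    exact ⟨hx, rfl⟩
  have hfinj : InjOn f (ball 0 1) := fun ζ hζ ξ hξ h => by
    rw [← (hright ζ hζ).2, h, (hright ξ hξ).2]
  have hpρ : ‖p - o‖ = ρ := by rw [hpdist, dist_eq_norm, norm_sub_rev]
  have htrans : MapsTo (fun x => x + o) (ball 0 ρ) (ball o ρ) := fun x hx => by
    simpa [dist_eq_norm] using hx
  have hkoebe : ‖deriv f 0‖ ≤ 55 / 4 * ρ := by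
    rw [← hpρ]
    refine norm_deriv_zero_le_of_notMem_image (φ := fun x => φ (x + o)) hfd hf0
      (norm_pos_iff.1 (hpρ ▸ hρ)) (fun ζ hζ h => hp ?_) ?_ ?_ (fun ζ hζ => (hright ζ hζ).2) ?_
    · have := (hright ζ hζ).1
      rwa [h, sub_add_cancel] at this
    · rw [hpρ]
      exact (hφ.continuousOn.mono hball).comp (by fun_prop) htrans
    · rw [hpρ]
      exact fun x hx => hbij.mapsTo (hball (htrans hx))
    · rw [hpρ]
      intro x hx
      rw [hleft _ (hball (htrans hx)), add_sub_cancel_right]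
  have hφball := hφ.mono hball
  have hmaps : MapsTo φ (ball o ρ) (ball 0 1) := hbij.mapsTo.mono_left hball
  have hshrink : ρ * δ * ‖φ x - φ y‖ / 8 ≤ ρ * ‖φ x - φ y‖ / 8 := by
    have : ρ * δ ≤ ρ := by nlinarith
    gcongr
  rcases le_or_gt ‖x - o‖ (3 / 4 * ρ) with hx1 | hx1
  · exact hshrink.trans
      (mul_norm_sub_div_eight_le_of_mapsTo_ball hρ hφball hmaps hx1 (hbij.mapsTo hy))
  rcases le_or_gt ‖y - o‖ (3 / 4 * ρ) with hy1 | hy1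
  · rw [norm_sub_rev x, norm_sub_rev (φ x)] at *
    exact hshrink.trans
      (mul_norm_sub_div_eight_le_of_mapsTo_ball hρ hφball hmaps hy1 (hbij.mapsTo hx))
  have hschwarz : ∀ x ∈ D, ρ * ‖φ x‖ ≤ ‖x - o‖ := by
    intro x hx
    rcases lt_or_ge (dist x o) ρ with h | h
    · have key := Complex.dist_le_div_mul_dist_of_mapsTo_ball (R₂ := 1) hφball
        (by rw [hφo]; exact hmaps.mono_right ball_subset_closedBall) (mem_ball.2 h)
      rw [hφo, dist_zero_right, dist_eq_norm, div_mul_eq_mul_div, le_div_iff₀ hρ] at key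
      linarith
    · rw [dist_eq_norm] at h
      have := mem_ball_zero_iff.1 (hbij.mapsTo hx)
      nlinarith
  have hpos : ∀ x ∈ D, 3 / 4 * ρ < ‖x - o‖ → 0 < ‖φ x‖ := by
    intro x hx h
    refine norm_pos_iff.2 fun h0 => ?_
    rw [hbij.injOn hx ho (h0.trans hφo.symm), sub_self, norm_zero] at h
    linarith
  have hgol := norm_mul_norm_mul_sqrt_le_of_injOn hfd hfinj hf0 (fun ζ hζ => (hfdiff ζ hζ).2)
    (mem_ball_zero_iff.1 (hbij.mapsTo hx)) (mem_ball_zero_iff.1 (hbij.mapsTo hy))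
  rw [hleft x hx, hleft y hy, sub_sub_sub_cancel_right] at hgol
  exact mul_mul_div_eight_le_of_mul_le hρ (norm_nonneg _) (hpos x hx hx1) (hpos y hy hy1)
    (norm_nonneg _) hδ hδ1 hxδ.le hyδ.le hx1.le hy1.le (hschwarz x hx) (hschwarz y hy) hkoebe hgol

/-- if `K ⊆ D` is compact and connected, `φ_D(K) ⊆ (1-δ)𝔻` and
`diam φ_D(K) ≥ ℓ`, then `diam K ≥ (ℓδ/8) ρ_D`. -/
theorem diameter_distortion_lower_bound
    (D : Set ℂ) (hDopen : IsOpen D) (hDconn : IsConnected D)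
    (hDsc : SimplyConnectedSpace D)
    (o₀ : ℂ) (ho₀ : o₀ ∈ D) (φ : ℂ → ℂ)
    (hφdiff : DifferentiableOn ℂ φ D)
    (hφbij : Set.BijOn φ D (Metric.ball (0:ℂ) 1))
    (hφo : φ o₀ = 0)
    (δ : ℝ) (hδ : 0 < δ) (hδ1 : δ < 1)
    (K : Set ℂ) (hKD : K ⊆ D) (hKcomp : IsCompact K) (hKconn : IsConnected K)
    (hKim : φ '' K ⊆ Metric.ball (0:ℂ) (1 - δ))
    (ℓ : ℝ) (hℓ : ℓ ≤ Metric.diam (φ '' K)) :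
    ℓ * δ / 8 * Metric.infDist o₀ Dᶜ ≤ Metric.diam K := by
  rcases (infDist_nonneg (x := o₀) (s := Dᶜ)).eq_or_lt with hρ | hρ
  · rw [← hρ, mul_zero]
    exact diam_nonneg
  have hdiam : diam (φ '' K) ≤ 8 * diam K / (infDist o₀ Dᶜ * δ) := by
    refine diam_le_of_forall_dist_le (div_nonneg (mul_nonneg (by norm_num) diam_nonneg)
      (by positivity)) ?_
    rintro _ ⟨x, hx, rfl⟩ _ ⟨y, hy, rfl⟩
    have h1 := infDist_mul_norm_sub_le hDopen ho₀ hφdiff hφbij hφo hδ hδ1 (hKD hx) (hKD hy)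
      (mem_ball_zero_iff.1 (hKim ⟨x, hx, rfl⟩)) (mem_ball_zero_iff.1 (hKim ⟨y, hy, rfl⟩))
    have h2 := dist_le_diam_of_mem hKcomp.isBounded hx hy
    rw [dist_eq_norm] at h2
    rw [dist_eq_norm, le_div_iff₀ (by positivity)]
    linarith
  have := hℓ.trans hdiam
  rw [le_div_iff₀ (by positivity)] at this
  linarith
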